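/- arXiv:2604.23682 — 2 statements merged into one kernel-verified Lean document; each statement's English description precedes it below -/
import Mathlib

section
/- Let u be a solution of the free boundary equation and assume the origin is a singular point. Then there exists a unique symmetric n×n real matrix A₀ with trace(A₀) = 1 such that the rescalings u_r(x) := (u(rx) − u(0))/r² converge, as r ↓ 0, to the quadratic polynomial q₀(x) := (1/2) x·A₀x in C¹ locally uniformly on ℝⁿ; that is, on every compact set K ⊂ ℝⁿ, both sup_K |u_r − q₀| → 0 and sup_K |∇u_r − ∇q₀| → 0 as r ↓ 0. -/
open MeasureTheory Metric Filter Topology Pointwise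

noncomputable section

abbrev En (n : ℕ) := EuclideanSpace ℝ (Fin n)

/-- symmetric trace-free matrices -/
def S0 {n : ℕ} (B : Matrix (Fin n) (Fin n) ℝ) : Prop := B.IsSymm ∧ B.trace = 0

/-- ψ_B(x) = (1/2) x·Bx -/
def psiM {n : ℕ} (B : Matrix (Fin n) (Fin n) ℝ) (x : En n) : ℝ :=
  (1/2) * ∑ i, ∑ j, B i j * x i * x j

/-- p₀(x) = |x|²/(2n) -/
def p0 (n : ℕ) (x : En n) : ℝ := ‖x‖^2 / (2*n)

/-- q_B = p₀ + ψ_B -/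
def qB {n : ℕ} (B : Matrix (Fin n) (Fin n) ℝ) (x : En n) : ℝ := p0 n x + psiM B x

/-- surface measure on the unit sphere -/
def sphMeas (n : ℕ) : Measure (En n) :=
  (Measure.hausdorffMeasure ((n:ℝ) - 1)).restrict (sphere (0:En n) 1)

/-- total surface area of the unit sphere -/
def sphArea (n : ℕ) : ℝ := (sphMeas n Set.univ).toReal

/-- u is a C^{1,1} solution of Δu = χ_{|∇u|>0} in B₁ with 0 a free boundary point. -/
def SolutionHyp {n : ℕ} (u : En n → ℝ) : Prop :=
  (∀ x ∈ ball (0:En n) 1, DifferentiableAt ℝ u x) ∧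
  (∃ L : NNReal, LipschitzOnWith L (fun x => gradient u x) (ball (0:En n) 1)) ∧
  (∀ᵐ x ∂(volume.restrict (ball (0:En n) 1)),
      ∃ D : En n →L[ℝ] En n, HasFDerivAt (fun y => gradient u y) D x ∧
        ((gradient u x = 0 → LinearMap.trace ℝ (En n) (D : En n →ₗ[ℝ] En n) = 0) ∧
         (gradient u x ≠ 0 → LinearMap.trace ℝ (En n) (D : En n →ₗ[ℝ] En n) = 1))) ∧
  ((0:En n) ∈ frontier {x | x ∈ ball (0:En n) 1 ∧ gradient u x ≠ 0}) ∧
  gradient u 0 = 0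

/-- the quadratic rescaling u_t(x) = e^{2t}(u(e^{-t}x)-u(0)) -/
def ut {n : ℕ} (u : En n → ℝ) (t : ℝ) (x : En n) : ℝ :=
  Real.exp (2*t) * (u (Real.exp (-t) • x) - u 0)

/-- Λ = {x ∈ B₁ : ∇u(x)=0} -/
def Lam {n : ℕ} (u : En n → ℝ) : Set (En n) :=
  {x | x ∈ ball (0:En n) 1 ∧ gradient u x = 0}

/-- Λ_t = e^t Λ -/
def LamT {n : ℕ} (u : En n → ℝ) (t : ℝ) : Set (En n) := Real.exp t • Lam u

/-- B(t) is the L²(∂B₁)-projection coefficient of u_t - p₀ -/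
def BProp {n : ℕ} (u : En n → ℝ) (B : ℝ → Matrix (Fin n) (Fin n) ℝ) : Prop :=
  ∀ t, 0 < t → S0 (B t) ∧
    ∀ C, S0 C →
      ∫ x, (ut u t x - p0 n x - psiM (B t) x) * psiM C x ∂(sphMeas n) = 0

/-- remainder R_t = u_t - q_{B(t)} -/
def Rt {n : ℕ} (u : En n → ℝ) (B : ℝ → Matrix (Fin n) (Fin n) ℝ) (t : ℝ) (x : En n) : ℝ :=
  ut u t x - qB (B t) x

/-- F(t) = ∫_{Λ_t ∩ B₁} |x|² dx -/
def Fdef {n : ℕ} (u : En n → ℝ) (t : ℝ) : ℝ :=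
  ∫ x in LamT u t ∩ ball (0:En n) 1, ‖x‖^2

/-- I(t) = ∫_{Λ_t ∩ B₁} x·∇R_t dx -/
def Idef {n : ℕ} (u : En n → ℝ) (B : ℝ → Matrix (Fin n) (Fin n) ℝ) (t : ℝ) : ℝ :=
  ∫ x in LamT u t ∩ ball (0:En n) 1, ∑ i, x i * gradient (Rt u B t) x i

/-- the origin is a singular point -/
def IsSingular {n : ℕ} (u : En n → ℝ) : Prop :=
  ∃ (r : ℕ → ℝ) (Bstar : Matrix (Fin n) (Fin n) ℝ),
    (∀ k, 0 < r k) ∧ Tendsto r atTop (nhds 0) ∧ S0 Bstar ∧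
    (∀ K : Set (En n), IsCompact K →
      TendstoUniformlyOn (fun k x => (u (r k • x) - u 0) / (r k)^2) (qB Bstar) atTop K ∧
      TendstoUniformlyOn (fun k x => gradient (fun y => (u (r k • y) - u 0) / (r k)^2) x)
        (fun x => gradient (qB Bstar) x) atTop K)

/-- Frobenius norm -/
def frob {n : ℕ} (M : Matrix (Fin n) (Fin n) ℝ) : ℝ := Real.sqrt (∑ i, ∑ j, (M i j)^2)

/-- the annulus 1/2 < |x| < 1 -/
def ann0 (n : ℕ) : Set (En n) := {x | 1/2 < ‖x‖ ∧ ‖x‖ < 1}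

/-- the dyadic annulus 2^{-k-1} < |x| < 2^{-k} -/
def annK (n : ℕ) (k : ℕ) : Set (En n) :=
  {x | (2:ℝ)^(-(k:ℤ)-1) < ‖x‖ ∧ ‖x‖ < (2:ℝ)^(-(k:ℤ))}

def F0 {n : ℕ} (u : En n → ℝ) (t : ℝ) : ℝ := ∫ x in LamT u t ∩ ann0 n, ‖x‖^2

def Fk {n : ℕ} (u : En n → ℝ) (k : ℕ) (t : ℝ) : ℝ := ∫ x in LamT u t ∩ annK n k, ‖x‖^2

def I0 {n : ℕ} (u : En n → ℝ) (B : ℝ → Matrix (Fin n) (Fin n) ℝ) (t : ℝ) : ℝ :=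
  ∫ x in LamT u t ∩ ann0 n, ∑ i, x i * gradient (Rt u B t) x i

def Ik {n : ℕ} (u : En n → ℝ) (B : ℝ → Matrix (Fin n) (Fin n) ℝ) (k : ℕ) (t : ℝ) : ℝ :=
  ∫ x in LamT u t ∩ annK n k, ∑ i, x i * gradient (Rt u B t) x i

/-- ε(t) = sup_{1/2 ≤ |x| ≤ 1} |∇R_t(x)| -/
def epsd {n : ℕ} (u : En n → ℝ) (B : ℝ → Matrix (Fin n) (Fin n) ℝ) (t : ℝ) : ℝ :=
  ⨆ x ∈ {x : En n | 1/2 ≤ ‖x‖ ∧ ‖x‖ ≤ 1}, ‖gradient (Rt u B t) x‖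

/-- trace-free part of a matrix -/
def tf {n : ℕ} (M : Matrix (Fin n) (Fin n) ℝ) : Matrix (Fin n) (Fin n) ℝ :=
  Matrix.of fun i j => M i j - (M.trace / n) * (if i = j then 1 else 0)

/-- second moment matrix of Λ_t ∩ B₁ -/
def momMat {n : ℕ} (u : En n → ℝ) (t : ℝ) : Matrix (Fin n) (Fin n) ℝ :=
  Matrix.of fun i j => ∫ x in LamT u t ∩ ball (0:En n) 1, x i * x j

/-- V(t) -/
def Vdef {n : ℕ} (u : En n → ℝ) (t : ℝ) : ℝ :=
  ∑' k : ℕ, (2:ℝ)^(-((k * (n+2) : ℕ) : ℤ)) * F0 u (t + k * Real.log 2) *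
    ∫ τ in t..(t + k * Real.log 2), Fdef u τ

section LipschitzCalculus

set_option linter.unusedSectionVars false

variable {E : Type*} [NormedAddCommGroup E] [NormedSpace ℝ E] [FiniteDimensional ℝ E]
  [MeasurableSpace E] [BorelSpace E] {μ : Measure E} [μ.IsAddHaarMeasure]
  {C D : NNReal} {f g : E → ℝ}

theorem lineDeriv_comp_add_right (g : E → ℝ) (a x v : E) :
    lineDeriv ℝ (fun y => g (y + a)) x v = lineDeriv ℝ g (x + a) v := by
  simp only [lineDeriv, add_right_comm]

theorem lineDeriv_eq_zero_of_notMem_tsupport {g : E → ℝ} {x : E} (hx : x ∉ tsupport g) (v : E) :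
    lineDeriv ℝ g x v = 0 := by
  rw [(notMem_tsupport_iff_eventuallyEq.1 hx).lineDeriv_eq]
  simp [lineDeriv]

theorem integral_lineDeriv_mul_lineDeriv_comm (hf : LipschitzWith C f) (hg : LipschitzWith D g)
    (h'g : HasCompactSupport g) (v w : E) :
    ∫ x, lineDeriv ℝ f x v * lineDeriv ℝ g x w ∂μ =
      ∫ x, lineDeriv ℝ f x w * lineDeriv ℝ g x v ∂μ := by
  have hgw : Integrable (fun x => lineDeriv ℝ g x (-w)) μ := by
    obtain ⟨R, hR⟩ := h'g.isCompact.isBounded.subset_closedBall (0 : E)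
    have hb : Integrable ((closedBall (0 : E) R).indicator
        (fun x => lineDeriv ℝ g x (-w))) μ := by
      rw [integrable_indicator_iff measurableSet_closedBall]
      exact (hg.locallyIntegrable_lineDeriv (-w)).integrableOn_isCompact
        (isCompact_closedBall _ _)
    refine hb.congr (.of_forall fun x => ?_)
    by_cases hx : x ∈ closedBall (0 : E) R
    · simp [hx]
    · have hx' : x ∉ tsupport g := fun h => hx (hR h)
      have h0 := lineDeriv_eq_zero_of_notMem_tsupport hx' (-w)
      simp [hx, h0]
  have A := hf.integral_inv_smul_sub_mul_tendsto_integral_lineDeriv_mul hgw v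
  obtain ⟨R, hR⟩ := h'g.isCompact.isBounded.subset_closedBall (0 : E)
  set K := closedBall (0 : E) (R + ‖v‖) with hK
  have hfw : Integrable (K.indicator fun x => lineDeriv ℝ f x w) μ := by
    rw [integrable_indicator_iff measurableSet_closedBall]
    exact (hf.locallyIntegrable_lineDeriv w).integrableOn_isCompact (isCompact_closedBall _ _)
  have B := hg.integral_inv_smul_sub_mul_tendsto_integral_lineDeriv_mul hfw (-v)
  have key : ∀ t : ℝ, 0 < t → t ≤ 1 →
      ∫ x, (t⁻¹ • (f (x + t • v) - f x)) * lineDeriv ℝ g x (-w) ∂μ =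
      ∫ x, (t⁻¹ • (g (x + t • -v) - g x)) * K.indicator (fun x => lineDeriv ℝ f x w) x ∂μ := by
    intro t ht ht1
    have hind : ∀ x, (t⁻¹ • (g (x + t • -v) - g x)) * K.indicator (fun x => lineDeriv ℝ f x w) x =
        t⁻¹ * (lineDeriv ℝ f x w * g (x + t • -v) - lineDeriv ℝ f x w * g x) := by
      intro x
      by_cases hx : x ∈ K
      · simp [hx]; ring
      · have h1 : g x = 0 := by
          by_contra h
          have h2 := hR (subset_tsupport _ (Function.mem_support.2 h))
          apply hx
          simp only [hK, mem_closedBall_zero_iff] at h2 ⊢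
          linarith [norm_nonneg v]
        have h3 : g (x + t • -v) = 0 := by
          by_contra h
          have h2 := hR (subset_tsupport _ (Function.mem_support.2 h))
          apply hx
          simp only [hK, mem_closedBall_zero_iff] at h2 ⊢
          have : x = (x + t • -v) + t • v := by simp
          rw [this]
          refine (norm_add_le _ _).trans ?_
          rw [norm_smul, Real.norm_of_nonneg ht.le]
          nlinarith [norm_nonneg v]
        rw [h1, h3]; simp
    simp_rw [hind]
    have hind2 : ∀ x, (t⁻¹ • (f (x + t • v) - f x)) * lineDeriv ℝ g x (-w) =
        t⁻¹ * (f (x + t • v) * lineDeriv ℝ g x (-w) - lineDeriv ℝ g x (-w) * f x) := by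
      intro x; simp; ring
    simp_rw [hind2]
    rw [integral_const_mul, integral_const_mul]
    congr 1
    have hgs : LipschitzWith D (fun x => g (x + t • -v)) := by
      intro x y
      simpa using hg (x + t • -v) (y + t • -v)
    have hgsc : HasCompactSupport (fun x => g (x + t • -v)) :=
      h'g.comp_homeomorph (Homeomorph.addRight (t • (-v)))
    have hi : ∀ (k : E → ℝ) (D : NNReal), LipschitzWith D k → HasCompactSupport k →
        Integrable (fun x => lineDeriv ℝ f x w * k x) μ := by
      intro k D hk hkc
      exact (hk.continuous.integrable_of_hasCompactSupport hkc).smul_of_top_right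
        (hf.memLp_lineDeriv w)
    have hi2 : ∀ (k : E → ℝ) , Continuous k →
        Integrable (fun x => k x * lineDeriv ℝ g x (-w)) μ := by
      intro k hk
      obtain ⟨M, hM⟩ := ((isCompact_closedBall (0 : E) R).image hk.norm).bddAbove
      have : Integrable (fun x => M * ‖lineDeriv ℝ g x (-w)‖) μ := hgw.norm.const_mul _
      refine this.mono' (hk.aestronglyMeasurable.mul hgw.aestronglyMeasurable)
        (.of_forall fun x => ?_)
      by_cases hx : x ∈ closedBall (0 : E) R
      · rw [norm_mul]
        exact mul_le_mul_of_nonneg_right (hM (Set.mem_image_of_mem _ hx)) (norm_nonneg _)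
      · have hx' : x ∉ tsupport g := fun h => hx (hR h)
        have h0 := lineDeriv_eq_zero_of_notMem_tsupport hx' (-w)
        simp [h0]
    rw [integral_sub (hi2 (fun x => f (x + t • v)) (hf.continuous.comp (continuous_add_const _)))
        (by simpa only [mul_comm] using hi2 f hf.continuous),
      integral_sub (hi _ _ hgs hgsc) (hi _ _ hg h'g),
      hf.integral_lineDeriv_mul_eq hgs hgsc, hf.integral_lineDeriv_mul_eq hg h'g]
    congr 1
    rw [← integral_add_right_eq_self _ (t • (-v))]
    refine integral_congr_ae (.of_forall fun x => ?_)
    simp only [lineDeriv_comp_add_right]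
    simp [mul_comm]
  have hE := tendsto_nhds_unique (A.congr' (by
    filter_upwards [Ioc_mem_nhdsGT zero_lt_one] with t ht using key t ht.1 ht.2)) B
  have h1 : ∀ x, lineDeriv ℝ g x (-v) * K.indicator (fun x => lineDeriv ℝ f x w) x =
      - (lineDeriv ℝ f x w * lineDeriv ℝ g x v) := by
    intro x
    by_cases hx : x ∈ K
    · simp [hx, lineDeriv_neg, mul_comm]
    · have hx' : x ∉ tsupport g := by
        intro h
        have h2 := hR h
        apply hx
        simp only [hK, mem_closedBall_zero_iff] at h2 ⊢
        linarith [norm_nonneg v]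
      have h0 := lineDeriv_eq_zero_of_notMem_tsupport hx' v
      simp [hx, h0]
  simp_rw [h1, lineDeriv_neg, mul_neg, integral_neg] at hE
  linarith

theorem integral_fderiv_mul_fderiv_comm (hf : LipschitzWith C f) (hg : LipschitzWith D g)
    (h'g : HasCompactSupport g) (v w : E) :
    ∫ x, fderiv ℝ f x v * fderiv ℝ g x w ∂μ = ∫ x, fderiv ℝ f x w * fderiv ℝ g x v ∂μ := by
  have h : ∀ v w : E, ∫ x, fderiv ℝ f x v * fderiv ℝ g x w ∂μ =
      ∫ x, lineDeriv ℝ f x v * lineDeriv ℝ g x w ∂μ := by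
    intro v w
    refine integral_congr_ae ?_
    filter_upwards [hf.ae_differentiableAt, hg.ae_differentiableAt] with x h1 h2
    rw [h1.lineDeriv_eq_fderiv, h2.lineDeriv_eq_fderiv]
  rw [h, h, integral_lineDeriv_mul_lineDeriv_comm hf hg h'g]

theorem integral_fderiv_mul_eq_neg (hf : LipschitzWith C f) (hg : LipschitzWith D g)
    (h'g : HasCompactSupport g) (v : E) :
    ∫ x, fderiv ℝ f x v * g x ∂μ = - ∫ x, f x * fderiv ℝ g x v ∂μ := by
  have h1 : ∫ x, fderiv ℝ f x v * g x ∂μ = ∫ x, lineDeriv ℝ f x v * g x ∂μ := by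
    refine integral_congr_ae ?_
    filter_upwards [hf.ae_differentiableAt] with x h1
    rw [h1.lineDeriv_eq_fderiv]
  have h2 : ∫ x, f x * fderiv ℝ g x v ∂μ = - ∫ x, lineDeriv ℝ g x (-v) * f x ∂μ := by
    rw [← integral_neg]
    refine integral_congr_ae ?_
    filter_upwards [hg.ae_differentiableAt] with x h1
    simp only [lineDeriv_neg]
    rw [h1.lineDeriv_eq_fderiv]; ring
  rw [h1, h2, neg_neg, hf.integral_lineDeriv_mul_eq hg h'g]

theorem abs_fderiv_apply_le (hf : LipschitzWith C f) (x v : E) : |fderiv ℝ f x v| ≤ C * ‖v‖ :=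
  (fderiv ℝ f x).le_of_opNorm_le (norm_fderiv_le_of_lipschitz ℝ hf) v

theorem integrable_fderiv_mul (hf : LipschitzWith C f) (hg : Integrable g μ) (v : E) :
    Integrable (fun x => fderiv ℝ f x v * g x) μ :=
  hg.bdd_mul (measurable_fderiv_apply_const ℝ f v).aestronglyMeasurable
    (.of_forall fun x => abs_fderiv_apply_le hf x v)

theorem integrable_fderiv_apply (hg : LipschitzWith D g) (h'g : HasCompactSupport g) (v : E) :
    Integrable (fun x => fderiv ℝ g x v) μ := by
  have h : Integrable ((tsupport g).indicator fun _ => (D * ‖v‖ : ℝ)) μ := by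
    rw [integrable_indicator_iff h'g.isCompact.measurableSet]
    exact integrableOn_const h'g.isCompact.measure_lt_top.ne
  refine h.mono' (measurable_fderiv_apply_const ℝ g v).aestronglyMeasurable
    (.of_forall fun x => ?_)
  by_cases hx : x ∈ tsupport g
  · simpa [hx] using abs_fderiv_apply_le hg x v
  · have : fderiv ℝ g x = 0 := by
      rw [(notMem_tsupport_iff_eventuallyEq.1 hx).fderiv_eq]
      exact fderiv_const_apply _
    simp [hx, this]

theorem exists_lipschitzWith_mul {M : ℝ} (hf : LipschitzWith C f) (hg : LipschitzWith D g)
    (hfM : ∀ x, g x ≠ 0 → |f x| ≤ M) (hgM : ∀ x, |g x| ≤ M) :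
    ∃ K, LipschitzWith K (fun x => f x * g x) := by
  have hM : 0 ≤ M := (abs_nonneg _).trans (hgM 0)
  refine ⟨⟨M * D + M * C, by positivity⟩, LipschitzWith.of_dist_le_mul ?_⟩
  have key : ∀ x y, g x ≠ 0 → |f x * g x - f y * g y| ≤ (M * D + M * C) * dist x y := by
    intro x y hx
    have h1 : f x * g x - f y * g y = f x * (g x - g y) + g y * (f x - f y) := by ring
    rw [h1]
    refine (abs_add_le _ _).trans ?_
    rw [abs_mul, abs_mul]
    have h2 := hf.dist_le_mul x y
    have h3 := hg.dist_le_mul x y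
    rw [Real.dist_eq] at h2 h3
    have h4 := mul_le_mul (hfM x hx) h3 (abs_nonneg _) hM
    have h5 := mul_le_mul (hgM y) h2 (abs_nonneg _) hM
    linarith
  intro x y
  rw [Real.dist_eq]
  change _ ≤ (M * D + M * C) * dist x y
  by_cases hx : g x = 0
  · by_cases hy : g y = 0
    · simp only [hx, hy, mul_zero, sub_zero, abs_zero]; positivity
    · rw [abs_sub_comm, dist_comm]; exact key y x hy
  · exact key x y hx

end LipschitzCalculus

section WeightedIdentities

variable {n : ℕ}

/-- A radial weight `η` vanishing off the unit ball, with `∇η = -κ x`. -/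
structure IsWeight (η κ : En n → ℝ) : Prop where
  continuous_kappa : Continuous κ
  kappa_nonneg : ∀ x, 0 ≤ κ x
  eta_nonneg : ∀ x, 0 ≤ η x
  eta_zero : ∀ x, 1 ≤ ‖x‖ → η x = 0
  kappa_zero : ∀ x, 1 ≤ ‖x‖ → κ x = 0
  hasFDerivAt : ∀ x, HasFDerivAt η (-(κ x) • innerSL ℝ x) x

/-- A Lipschitz field whose derivative is symmetric with trace `f` a.e. in the unit ball. -/
structure IsGradField (a : En n → En n) (f : En n → ℝ) : Prop where
  lip : ∃ C, LipschitzWith C a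
  ae_fderiv : ∀ᵐ x, x ∈ ball (0 : En n) 1 → DifferentiableAt ℝ a x ∧
    (∀ v w, inner ℝ (fderiv ℝ a x v) w = inner ℝ (fderiv ℝ a x w) v) ∧
    LinearMap.trace ℝ (En n) (fderiv ℝ a x : En n →ₗ[ℝ] En n) = f x

namespace IsWeight

variable {η κ : En n → ℝ}

theorem continuous_eta (h : IsWeight η κ) : Continuous η :=
  continuous_iff_continuousAt.2 fun x => (h.hasFDerivAt x).continuousAt

theorem hasCompactSupport_eta (h : IsWeight η κ) : HasCompactSupport η :=
  HasCompactSupport.intro (isCompact_closedBall (0 : En n) 1) fun x hx => h.eta_zero x (by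
    simp at hx; exact hx.le)

theorem hasCompactSupport_kappa (h : IsWeight η κ) : HasCompactSupport κ :=
  HasCompactSupport.intro (isCompact_closedBall (0 : En n) 1) fun x hx => h.kappa_zero x (by
    simp at hx; exact hx.le)

theorem exists_bound (h : IsWeight η κ) : ∃ M : ℝ, 0 ≤ M ∧ (∀ x, η x ≤ M) ∧ ∀ x, κ x ≤ M := by
  obtain ⟨M, hM⟩ := h.hasCompactSupport_eta.exists_bound_of_continuous h.continuous_eta
  obtain ⟨N, hN⟩ := h.hasCompactSupport_kappa.exists_bound_of_continuous h.continuous_kappa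
  refine ⟨max M N, ?_, fun x => ?_, fun x => ?_⟩
  · exact le_max_of_le_left ((norm_nonneg _).trans (hM 0))
  · exact le_max_of_le_left ((le_abs_self _).trans (hM x))
  · exact le_max_of_le_right ((le_abs_self _).trans (hN x))

theorem exists_lipschitzWith (h : IsWeight η κ) : ∃ C, LipschitzWith C η := by
  obtain ⟨M, hM0, -, hM⟩ := h.exists_bound
  refine ⟨M.toNNReal, lipschitzWith_of_nnnorm_fderiv_le
    (fun x => (h.hasFDerivAt x).differentiableAt) fun x => ?_⟩
  rw [(h.hasFDerivAt x).fderiv, ← NNReal.coe_le_coe]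
  simp only [coe_nnnorm, Real.coe_toNNReal _ hM0, norm_smul, innerSL_apply_norm, norm_neg]
  rw [Real.norm_of_nonneg (h.kappa_nonneg x)]
  by_cases hx : 1 ≤ ‖x‖
  · simp [h.kappa_zero x hx, hM0]
  · have := hM x
    have := h.kappa_nonneg x
    nlinarith [norm_nonneg x]

theorem fderiv_single (h : IsWeight η κ) (x : En n) (j : Fin n) :
    fderiv ℝ η x (EuclideanSpace.single j 1) = -(κ x * x j) := by
  rw [(h.hasFDerivAt x).fderiv]
  simp [EuclideanSpace.inner_single_right]

theorem integrable_mul_kappa (h : IsWeight η κ) {g : En n → ℝ} (hg : Continuous g) :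
    Integrable (fun x => g x * κ x) :=
  (hg.mul h.continuous_kappa).integrable_of_hasCompactSupport h.hasCompactSupport_kappa.mul_left

end IsWeight

variable {η κ : En n → ℝ} {a b : En n → En n} {f g : En n → ℝ}

theorem lipschitzWith_apply {C : NNReal} (ha : LipschitzWith C a) (i : Fin n) :
    LipschitzWith C (fun x => a x i) := by
  refine LipschitzWith.of_dist_le_mul fun x y => ?_
  refine le_trans ?_ (ha.dist_le_mul x y)
  rw [Real.dist_eq, dist_eq_norm]
  simpa using PiLp.norm_apply_le (a x - a y) i

theorem fderiv_apply_coord {x : En n} (ha : DifferentiableAt ℝ a x) (i : Fin n) (v : En n) :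
    fderiv ℝ (fun y => a y i) x v = fderiv ℝ a x v i := by
  have := ((EuclideanSpace.proj i : En n →L[ℝ] ℝ).hasFDerivAt.comp x ha.hasFDerivAt).fderiv
  have h2 : (EuclideanSpace.proj i : En n →L[ℝ] ℝ) ∘ a = fun y => a y i := rfl
  rw [h2] at this
  rw [this]; rfl

theorem trace_eq_sum_single (T : En n →L[ℝ] En n) :
    LinearMap.trace ℝ (En n) (T : En n →ₗ[ℝ] En n) =
      ∑ i, T (EuclideanSpace.single i 1) i := by
  rw [LinearMap.trace_eq_sum_inner _ (EuclideanSpace.basisFun (Fin n) ℝ)]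
  simp [EuclideanSpace.inner_single_left]

theorem apply_eq_sum_single (T : En n →L[ℝ] En n) (x : En n) (i : Fin n) :
    T x i = ∑ j, T (EuclideanSpace.single j 1) i * x j := by
  conv_lhs => rw [← (EuclideanSpace.basisFun (Fin n) ℝ).sum_repr x]
  simp [mul_comm]

theorem exists_lipschitzWith_coord_mul (h : IsWeight η κ) {C : NNReal} (hb : LipschitzWith C b)
    (i : Fin n) : ∃ K, LipschitzWith K (fun x => b x i * η x) := by
  obtain ⟨D, hD⟩ := h.exists_lipschitzWith
  obtain ⟨M, hM0, hM, -⟩ := h.exists_bound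
  obtain ⟨N, hN⟩ := (isCompact_closedBall (0 : En n) 1).exists_bound_of_continuousOn
    (lipschitzWith_apply hb i).continuous.continuousOn
  refine exists_lipschitzWith_mul (M := max M N) (lipschitzWith_apply hb i) hD
    (fun x hx => ?_) fun x => ?_
  · refine le_max_of_le_right (hN x ?_)
    by_contra hx'
    simp at hx'
    exact hx (h.eta_zero x hx'.le)
  · rw [abs_of_nonneg (h.eta_nonneg x)]
    exact le_max_of_le_left (hM x)

theorem fderiv_coord_mul (h : IsWeight η κ) {x : En n} (hb : DifferentiableAt ℝ b x)
    (i j : Fin n) : fderiv ℝ (fun x => b x i * η x) x (EuclideanSpace.single j 1) =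
      fderiv ℝ b x (EuclideanSpace.single j 1) i * η x - b x i * (κ x * x j) := by
  have hbi : DifferentiableAt ℝ (fun y => b y i) x :=
    (EuclideanSpace.proj i : En n →L[ℝ] ℝ).differentiableAt.comp x hb
  rw [fderiv_fun_mul hbi (h.hasFDerivAt x).differentiableAt]
  simp [h.fderiv_single, fderiv_apply_coord hb]
  ring

theorem IsGradField.integral_energy (h : IsWeight η κ) (ha : IsGradField a f)
    (hb : IsGradField b g) :
    ∃ S T : En n → ℝ, (∀ x, S x = ∑ i, ∑ j, fderiv ℝ a x (EuclideanSpace.single j 1) i *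
      fderiv ℝ b x (EuclideanSpace.single j 1) i) ∧ T = (fun x => S x * η x) ∧
    Integrable (fun x => T x - inner ℝ (b x) (fderiv ℝ a x x) * κ x) ∧
    Integrable (fun x => f x * g x * η x - f x * inner ℝ (b x) x * κ x) ∧
    ∫ x, (T x - inner ℝ (b x) (fderiv ℝ a x x) * κ x) =
      ∫ x, (f x * g x * η x - f x * inner ℝ (b x) x * κ x) := by
  obtain ⟨C, hC⟩ := ha.lip
  obtain ⟨D, hD⟩ := hb.lip
  refine ⟨_, _, fun x => rfl, rfl, ?_⟩
  set e : Fin n → En n := fun j => EuclideanSpace.single j 1 with he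
  set G : Fin n → En n → ℝ := fun i x => b x i * η x with hG
  have hGc : ∀ i, HasCompactSupport (G i) := fun i => h.hasCompactSupport_eta.mul_left
  have h_integ : ∀ i j k l, Integrable (fun x => fderiv ℝ (fun y => a y i) x (e j) *
      fderiv ℝ (G k) x (e l)) := by
    intro i j k l
    obtain ⟨K, hK⟩ := exists_lipschitzWith_coord_mul h hD k
    exact integrable_fderiv_mul (lipschitzWith_apply hC i)
      (integrable_fderiv_apply hK (hGc k) _) _
  have hL : Integrable (fun x => ∑ i, ∑ j, fderiv ℝ (fun y => a y i) x (e j) *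
      fderiv ℝ (G i) x (e j)) :=
    integrable_finsetSum _ fun i _ => integrable_finsetSum _ fun j _ => h_integ i j i j
  have hR : Integrable (fun x => ∑ i, ∑ j, fderiv ℝ (fun y => a y j) x (e j) *
      fderiv ℝ (G i) x (e i)) :=
    integrable_finsetSum _ fun i _ => integrable_finsetSum _ fun j _ => h_integ j j i i
  have hLR : ∫ x, ∑ i, ∑ j, fderiv ℝ (fun y => a y i) x (e j) * fderiv ℝ (G i) x (e j) =
      ∫ x, ∑ i, ∑ j, fderiv ℝ (fun y => a y j) x (e j) * fderiv ℝ (G i) x (e i) := by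
    have h1 : ∫ x, ∑ i, ∑ j, fderiv ℝ (fun y => a y i) x (e j) * fderiv ℝ (G i) x (e j) =
        ∫ x, ∑ i, ∑ j, fderiv ℝ (fun y => a y j) x (e i) * fderiv ℝ (G i) x (e j) := by
      refine integral_congr_ae ?_
      filter_upwards [ha.ae_fderiv, hC.ae_differentiableAt, hD.ae_differentiableAt]
        with x hx hax hbx
      refine Finset.sum_congr rfl fun i _ => Finset.sum_congr rfl fun j _ => ?_
      by_cases hx1 : x ∈ ball (0 : En n) 1
      · obtain ⟨-, hs, -⟩ := hx hx1
        rw [fderiv_apply_coord hax, fderiv_apply_coord hax]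
        have := hs (e j) (e i)
        simp only [he, EuclideanSpace.inner_single_right] at this
        simp at this
        rw [this]
      · have hx2 : 1 ≤ ‖x‖ := by simpa using hx1
        rw [fderiv_coord_mul h hbx, h.eta_zero x hx2, h.kappa_zero x hx2]
        simp
    rw [h1, integral_finsetSum _ fun i _ => integrable_finsetSum _ fun j _ => h_integ j i i j,
      integral_finsetSum _ fun i _ => integrable_finsetSum _ fun j _ => h_integ j j i i]
    refine Finset.sum_congr rfl fun i _ => ?_
    rw [integral_finsetSum _ fun j _ => h_integ j i i j,
      integral_finsetSum _ fun j _ => h_integ j j i i]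
    refine Finset.sum_congr rfl fun j _ => ?_
    obtain ⟨K, hK⟩ := exists_lipschitzWith_coord_mul h hD i
    exact integral_fderiv_mul_fderiv_comm (lipschitzWith_apply hC j) hK (hGc i) _ _
  have hLae : (fun x => ∑ i, ∑ j, fderiv ℝ (fun y => a y i) x (e j) *
      fderiv ℝ (G i) x (e j)) =ᵐ[volume] fun x => (∑ i, ∑ j, fderiv ℝ a x (e j) i *
      fderiv ℝ b x (e j) i) * η x - inner ℝ (b x) (fderiv ℝ a x x) * κ x := by
    filter_upwards [hC.ae_differentiableAt, hD.ae_differentiableAt] with x hax hbx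
    simp only [hG, he, fderiv_coord_mul h hbx, fderiv_apply_coord hax, PiLp.inner_apply,
      apply_eq_sum_single (fderiv ℝ a x) x, Finset.sum_mul, ← Finset.sum_sub_distrib]
    refine Finset.sum_congr rfl fun i _ => ?_
    simp only [RCLike.inner_apply, conj_trivial, Finset.sum_mul, ← Finset.sum_sub_distrib]
    refine Finset.sum_congr rfl fun j _ => ?_
    ring
  have hRae : (fun x => ∑ i, ∑ j, fderiv ℝ (fun y => a y j) x (e j) *
      fderiv ℝ (G i) x (e i)) =ᵐ[volume] fun x =>
      f x * g x * η x - f x * inner ℝ (b x) x * κ x := by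
    filter_upwards [ha.ae_fderiv, hb.ae_fderiv, hC.ae_differentiableAt, hD.ae_differentiableAt]
      with x hx hx' hax hbx
    simp only [hG, he, fderiv_coord_mul h hbx, fderiv_apply_coord hax]
    by_cases hx1 : x ∈ ball (0 : En n) 1
    · obtain ⟨-, -, hf⟩ := hx hx1
      obtain ⟨-, -, hg⟩ := hx' hx1
      rw [trace_eq_sum_single] at hf hg
      simp only [← Finset.sum_mul, hf, ← Finset.mul_sum, Finset.sum_sub_distrib]
      rw [hg, PiLp.inner_apply]
      simp only [RCLike.inner_apply, conj_trivial]
      rw [mul_sub, ← mul_assoc, mul_assoc (f x) (∑ i, _) (κ x), Finset.sum_mul]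
      congr 2
      exact Finset.sum_congr rfl fun i _ => by ring
    · have hx2 : 1 ≤ ‖x‖ := by simpa using hx1
      simp [h.eta_zero x hx2, h.kappa_zero x hx2]
  exact ⟨hL.congr hLae, hR.congr hRae,
    by rw [← integral_congr_ae hLae, hLR, integral_congr_ae hRae]⟩

/-- Green's identity for two gradient fields against a radial weight. -/
theorem IsGradField.integral_inner_fderiv_sub (h : IsWeight η κ) (ha : IsGradField a f)
    (hb : IsGradField b g) :
    ∫ x, (inner ℝ (a x) (fderiv ℝ b x x) - inner ℝ (b x) (fderiv ℝ a x x)) * κ x =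
      ∫ x, (g x * inner ℝ (a x) x - f x * inner ℝ (b x) x) * κ x := by
  obtain ⟨S, T, hS, hT, i1, i2, h1⟩ := ha.integral_energy h hb
  obtain ⟨S', T', hS', hT', i3, i4, h2⟩ := hb.integral_energy h ha
  have hTT : T' = T := by
    rw [hT, hT']
    funext x
    rw [hS, hS']
    simp only [mul_comm]
  rw [hTT] at i3 h2
  have e1 := integral_sub i1 i3
  have e2 := integral_sub i2 i4
  rw [h1, h2, ← e2] at e1
  calc _ = _ := integral_congr_ae (.of_forall fun x => by ring)
    _ = _ := e1
    _ = _ := integral_congr_ae (.of_forall fun x => by ring)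

theorem IsGradField.integral_mul_eta (h : IsWeight η κ) (ha : IsGradField a f) :
    Integrable (fun x => f x * η x) ∧ ∫ x, f x * η x = ∫ x, inner ℝ (a x) x * κ x := by
  obtain ⟨C, hC⟩ := ha.lip
  obtain ⟨D, hD⟩ := h.exists_lipschitzWith
  have hηi : Integrable η := h.continuous_eta.integrable_of_hasCompactSupport
    h.hasCompactSupport_eta
  have hi : ∀ i, Integrable (fun x => fderiv ℝ (fun y => a y i) x (EuclideanSpace.single i 1) *
      η x) := fun i => integrable_fderiv_mul (lipschitzWith_apply hC i) hηi _
  have hae : (fun x => ∑ i, fderiv ℝ (fun y => a y i) x (EuclideanSpace.single i 1) *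
      η x) =ᵐ[volume] fun x => f x * η x := by
    filter_upwards [ha.ae_fderiv] with x hx
    by_cases hx1 : x ∈ ball (0 : En n) 1
    · obtain ⟨hax, -, hf⟩ := hx hx1
      rw [trace_eq_sum_single] at hf
      simp only [fderiv_apply_coord hax, ← Finset.sum_mul, hf]
    · have hx2 : 1 ≤ ‖x‖ := by simpa using hx1
      simp [h.eta_zero x hx2]
  refine ⟨(integrable_finsetSum _ fun i _ => hi i).congr hae, ?_⟩
  rw [← integral_congr_ae hae, integral_finsetSum _ fun i _ => hi i]
  have hb : ∀ i, ∫ x, fderiv ℝ (fun y => a y i) x (EuclideanSpace.single i 1) * η x =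
      ∫ x, (a x i * x i) * κ x := by
    intro i
    rw [integral_fderiv_mul_eq_neg (lipschitzWith_apply hC i) hD h.hasCompactSupport_eta,
      ← integral_neg]
    refine integral_congr_ae (.of_forall fun x => ?_)
    simp only [h.fderiv_single]; ring
  simp only [hb]
  rw [← integral_finsetSum _ fun i _ => h.integrable_mul_kappa
    (g := fun x => a x i * x i) ((lipschitzWith_apply hC i).continuous.mul (by fun_prop))]
  refine integral_congr_ae (.of_forall fun x => ?_)
  simp only [PiLp.inner_apply, RCLike.inner_apply, conj_trivial, Finset.sum_mul]
  exact Finset.sum_congr rfl fun i _ => by ring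

end WeightedIdentities

section Dilations

variable {n : ℕ}

/-- The degree-one rescaling `x ↦ e^{-τ} w(e^τ x)`. -/
def dil (w : En n → En n) (τ : ℝ) (x : En n) : En n :=
  Real.exp (-τ) • w (Real.exp τ • x)

/-- The indicator function of the origin. -/
def zeroInd (x : En n) : ℝ := ({0} : Set (En n)).indicator 1 x

theorem zeroInd_zero : zeroInd (0 : En n) = 1 := by simp [zeroInd]

theorem zeroInd_of_ne {x : En n} (hx : x ≠ 0) : zeroInd x = 0 := by simp [zeroInd, hx]

theorem zeroInd_nonneg (x : En n) : 0 ≤ zeroInd x := by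
  by_cases hx : x = 0
  · simp [hx, zeroInd_zero]
  · simp [zeroInd_of_ne hx]

theorem zeroInd_le_one (x : En n) : zeroInd x ≤ 1 := by
  by_cases hx : x = 0
  · simp [hx, zeroInd_zero]
  · simp [zeroInd_of_ne hx]

theorem measurable_zeroInd : Measurable (zeroInd : En n → ℝ) :=
  measurable_one.indicator (measurableSet_singleton 0)

theorem zeroInd_smul {c : ℝ} (hc : c ≠ 0) (x : En n) : zeroInd (c • x) = zeroInd x := by
  by_cases hx : x = 0
  · simp [hx]
  · rw [zeroInd_of_ne hx, zeroInd_of_ne (smul_ne_zero hc hx)]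

variable {w : En n → En n} {C : NNReal}

theorem dil_lipschitzWith (hw : LipschitzWith C w) (τ : ℝ) : LipschitzWith C (dil w τ) := by
  refine LipschitzWith.of_dist_le_mul fun x y => ?_
  have h := hw.dist_le_mul (Real.exp τ • x) (Real.exp τ • y)
  rw [dist_eq_norm, dist_eq_norm] at *
  rw [dil, dil, ← smul_sub, norm_smul, Real.norm_of_nonneg (Real.exp_pos _).le]
  rw [← smul_sub, norm_smul, Real.norm_of_nonneg (Real.exp_pos _).le] at h
  have h2 := mul_le_mul_of_nonneg_left h (Real.exp_pos (-τ)).le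
  refine h2.trans (le_of_eq ?_)
  have : Real.exp (-τ) * Real.exp τ = 1 := by rw [← Real.exp_add]; simp
  linear_combination (C * ‖x - y‖ : ℝ) * this

theorem norm_dil_le (hw : LipschitzWith C w) (h0 : w 0 = 0) (τ : ℝ) (x : En n) :
    ‖dil w τ x‖ ≤ C * ‖x‖ := by
  have h := (dil_lipschitzWith hw τ).dist_le_mul x 0
  have h1 : dil w τ 0 = 0 := by simp [dil, h0]
  simpa [h1] using h

theorem norm_dil_sub_dil_le (hw : LipschitzWith C w) (h0 : w 0 = 0) (τ σ : ℝ) (x : En n) :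
    ‖dil w τ x - dil w σ x‖ ≤ 2 * C * ‖x‖ * |τ - σ| := by
  wlog hle : τ ≤ σ generalizing τ σ
  · rw [norm_sub_rev, abs_sub_comm]; exact this σ τ (le_of_not_ge hle)
  have e1 : Real.exp (-σ) * Real.exp σ = 1 := by rw [← Real.exp_add]; simp
  have e2 : Real.exp (-τ) * Real.exp τ = 1 := by rw [← Real.exp_add]; simp
  have e3 : Real.exp (-σ) * Real.exp τ = Real.exp (-(σ - τ)) := by
    rw [← Real.exp_add]; congr 1; ring
  have e4 : 1 - Real.exp (-(σ - τ)) ≤ σ - τ := by linarith [Real.add_one_le_exp (-(σ - τ))]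
  have hsplit : dil w τ x - dil w σ x = Real.exp (-σ) • (w (Real.exp τ • x) - w (Real.exp σ • x))
      + (Real.exp (-τ) - Real.exp (-σ)) • w (Real.exp τ • x) := by
    simp only [dil]; module
  have hm : Real.exp (-σ) ≤ Real.exp (-τ) := Real.exp_le_exp.2 (by linarith)
  have hm' : Real.exp τ ≤ Real.exp σ := Real.exp_le_exp.2 hle
  have n1 : ‖w (Real.exp τ • x) - w (Real.exp σ • x)‖ ≤
      C * ((Real.exp σ - Real.exp τ) * ‖x‖) := by
    have := hw.dist_le_mul (Real.exp τ • x) (Real.exp σ • x)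
    rw [dist_eq_norm, dist_eq_norm, ← sub_smul, norm_smul, Real.norm_eq_abs, abs_sub_comm,
      abs_of_nonneg (by linarith)] at this
    exact this
  have n2 : ‖w (Real.exp τ • x)‖ ≤ C * (Real.exp τ * ‖x‖) := by
    have := hw.dist_le_mul (Real.exp τ • x) 0
    rw [h0, dist_zero_right, dist_zero_right, norm_smul,
      Real.norm_of_nonneg (Real.exp_pos _).le] at this
    exact this
  rw [hsplit]
  refine (norm_add_le _ _).trans ?_
  rw [norm_smul, norm_smul, Real.norm_of_nonneg (Real.exp_pos _).le,
    Real.norm_of_nonneg (by linarith), abs_sub_comm, abs_of_nonneg (by linarith)]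
  have m1 := mul_le_mul_of_nonneg_left n1 (Real.exp_pos (-σ)).le
  have m2 := mul_le_mul_of_nonneg_left n2 (show 0 ≤ Real.exp (-τ) - Real.exp (-σ) by linarith)
  have m3 : Real.exp (-σ) * (C * ((Real.exp σ - Real.exp τ) * ‖x‖)) =
      C * ‖x‖ * (1 - Real.exp (-(σ - τ))) := by
    linear_combination (C * ‖x‖ : ℝ) * (e1 - e3)
  have m4 : (Real.exp (-τ) - Real.exp (-σ)) * (C * (Real.exp τ * ‖x‖)) =
      C * ‖x‖ * (1 - Real.exp (-(σ - τ))) := by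
    linear_combination (C * ‖x‖ : ℝ) * (e2 - e3)
  have m5 := mul_le_mul_of_nonneg_left e4 (show 0 ≤ (C * ‖x‖ : ℝ) by positivity)
  linarith

theorem hasFDerivAt_dil {τ : ℝ} {x : En n} (hd : DifferentiableAt ℝ w (Real.exp τ • x)) :
    HasFDerivAt (dil w τ) (fderiv ℝ w (Real.exp τ • x)) x := by
  have h1 : HasFDerivAt (fun y : En n => Real.exp τ • y)
      (Real.exp τ • ContinuousLinearMap.id ℝ (En n)) x :=
    (Real.exp τ • ContinuousLinearMap.id ℝ (En n)).hasFDerivAt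
  have h2 := (hd.hasFDerivAt.comp x h1).const_smul (Real.exp (-τ))
  refine h2.congr_fderiv ?_
  ext v : 1
  have : Real.exp (-τ) * Real.exp τ = 1 := by rw [← Real.exp_add]; simp
  simp [smul_smul, this]

theorem hasDerivAt_dil {τ : ℝ} {x : En n} (hd : DifferentiableAt ℝ w (Real.exp τ • x)) :
    HasDerivAt (fun s => dil w s x) (fderiv ℝ (dil w τ) x x - dil w τ x) τ := by
  have h1 : HasDerivAt (fun s => Real.exp s • x) (Real.exp τ • x) τ :=
    (Real.hasDerivAt_exp τ).smul_const x
  have h2 : HasDerivAt (fun s => w (Real.exp s • x))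
      (fderiv ℝ w (Real.exp τ • x) (Real.exp τ • x)) τ :=
    hd.hasFDerivAt.comp_hasDerivAt τ h1
  have h3 : HasDerivAt (fun s => Real.exp (-s)) (-Real.exp (-τ)) τ := by
    simpa using (hasDerivAt_neg τ).exp
  refine (h3.smul h2).congr_deriv ?_
  rw [(hasFDerivAt_dil hd).fderiv, map_smul, smul_smul]
  have : Real.exp (-τ) * Real.exp τ = 1 := by rw [← Real.exp_add]; simp
  rw [this, dil]
  module

theorem ae_exp_smul {p : En n → Prop} (hp : ∀ᵐ x, p x) (τ : ℝ) :
    ∀ᵐ x, p (Real.exp τ • x) :=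
  (Measure.quasiMeasurePreserving_smul (μ := volume) (Real.exp_pos τ).ne').ae hp

theorem exp_smul_mem_ball {τ : ℝ} (hτ : τ ≤ 0) {x : En n} (hx : x ∈ ball (0 : En n) 1) :
    Real.exp τ • x ∈ ball (0 : En n) 1 := by
  simp only [mem_ball_zero_iff] at *
  rw [norm_smul, Real.norm_of_nonneg (Real.exp_pos _).le]
  have := Real.exp_le_one_iff.2 hτ
  nlinarith [norm_nonneg x, Real.exp_pos τ]

theorem IsGradField.dil (hw : IsGradField w fun x => 1 - zeroInd (w x)) {τ : ℝ} (hτ : τ ≤ 0) :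
    IsGradField (dil w τ) fun x => 1 - zeroInd (dil w τ x) := by
  obtain ⟨C, hC⟩ := hw.lip
  refine ⟨⟨C, dil_lipschitzWith hC τ⟩, ?_⟩
  filter_upwards [ae_exp_smul hw.ae_fderiv τ] with x hx hx1
  obtain ⟨h1, h2, h3⟩ := hx (exp_smul_mem_ball hτ hx1)
  have hd := hasFDerivAt_dil h1
  refine ⟨hd.differentiableAt, ?_, ?_⟩
  · rw [hd.fderiv]; exact h2
  · rw [hd.fderiv, h3, _root_.dil, zeroInd_smul (Real.exp_pos _).ne']

/-- Differentiation under a compactly supported weighted integral of functions that are Lipschitz in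
the parameter. -/
theorem IsWeight.hasDerivAt_integral {η κ : En n → ℝ} (h : IsWeight η κ) {F : ℝ → En n → ℝ}
    {F' : En n → ℝ} {M s₀ : ℝ} (hM : 0 ≤ M) (hF : ∀ s, Continuous (F s))
    (hlip : ∀ s t x, ‖x‖ ≤ 1 → |F s x - F t x| ≤ M * |s - t|)
    (hd : ∀ᵐ x, HasDerivAt (fun s => F s x) (F' x) s₀) :
    HasDerivAt (fun s => ∫ x, F s x * κ x) (∫ x, F' x * κ x) s₀ := by
  have hd' : ∀ᵐ x, HasDerivAt (fun s => F s x * κ x) (F' x * κ x) s₀ := by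
    filter_upwards [hd] with x hx using hx.mul_const _
  have hmeas : AEStronglyMeasurable (fun x => F' x * κ x) volume := by
    have hu : Tendsto (fun k : ℕ => (1 / ((k : ℝ) + 1))) atTop (𝓝[>] 0) :=
      tendsto_nhdsWithin_iff.2 ⟨tendsto_one_div_add_atTop_nhds_zero_nat,
        .of_forall fun k => by simp only [Set.mem_Ioi]; positivity⟩
    refine aestronglyMeasurable_of_tendsto_ae (u := atTop) (f := fun (k : ℕ) x =>
      (1 / ((k : ℝ) + 1))⁻¹ • (F (s₀ + 1 / ((k : ℝ) + 1)) x * κ x - F s₀ x * κ x))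
      (fun k => ?_) ?_
    · have h1 := (hF (s₀ + 1 / ((k : ℝ) + 1))).mul h.continuous_kappa
      have h2 := (hF s₀).mul h.continuous_kappa
      exact ((h1.sub h2).const_smul ((1 / ((k : ℝ) + 1))⁻¹)).aestronglyMeasurable
    · filter_upwards [hd'] with x hx
      exact hx.tendsto_slope_zero_right.comp hu
  refine (hasDerivAt_integral_of_dominated_loc_of_lip (bound := fun x => M * κ x)
    (F := fun s x => F s x * κ x)
    univ_mem (.of_forall fun s => ((hF s).mul h.continuous_kappa).aestronglyMeasurable)
    (h.integrable_mul_kappa (hF s₀)) hmeas (.of_forall fun x => ?_)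
    (h.integrable_mul_kappa continuous_const) hd').2
  refine LipschitzWith.lipschitzOnWith (LipschitzWith.of_dist_le_mul fun s t => ?_)
  have hk := h.kappa_nonneg x
  rw [Real.dist_eq, Real.dist_eq, Real.coe_nnabs, abs_of_nonneg (mul_nonneg hM hk), ← sub_mul,
    abs_mul, abs_of_nonneg hk]
  by_cases hx : ‖x‖ ≤ 1
  · nlinarith [hlip s t x hx]
  · simp [h.kappa_zero x (le_of_not_ge hx)]

theorem exists_measureReal_small (hw : Continuous w) {ε : ℝ} (hε : 0 < ε) :
    ∃ δ > 0, volume.real {y : En n | y ∈ ball (0 : En n) 1 ∧ w y ≠ 0 ∧ ‖w y‖ ≤ δ} < ε := by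
  set S : ℕ → Set (En n) := fun k =>
    {y : En n | y ∈ ball (0 : En n) 1 ∧ w y ≠ 0 ∧ ‖w y‖ ≤ 1 / ((k : ℝ) + 1)} with hS
  have hmeas : ∀ k, MeasurableSet (S k) := fun k => by
    refine measurableSet_ball.inter (MeasurableSet.inter ?_ ?_)
    · exact (isOpen_ne_fun hw continuous_const).measurableSet
    · exact (isClosed_le hw.norm continuous_const).measurableSet
  have hanti : Antitone S := by
    intro k l hkl y hy
    refine ⟨hy.1, hy.2.1, hy.2.2.trans ?_⟩
    exact one_div_le_one_div_of_le (by positivity) (by gcongr)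
  have hfin : volume (S 0) ≠ ⊤ :=
    ((measure_mono fun y hy => hy.1).trans_lt measure_ball_lt_top).ne
  have ht := tendsto_measure_iInter_atTop (μ := volume) (fun k => (hmeas k).nullMeasurableSet)
    hanti ⟨0, hfin⟩
  have hempty : ⋂ k, S k = ∅ := by
    rw [Set.eq_empty_iff_forall_notMem]
    intro y hy
    have h1 := Set.mem_iInter.1 hy
    have h2 : ‖w y‖ ≤ 0 := ge_of_tendsto' tendsto_one_div_add_atTop_nhds_zero_nat
      fun k => (h1 k).2.2
    exact (h1 0).2.1 (norm_le_zero_iff.1 h2)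
  rw [hempty, measure_empty] at ht
  obtain ⟨k, hk⟩ := (ht.eventually (gt_mem_nhds (ENNReal.ofReal_pos.2 hε))).exists
  refine ⟨1 / ((k : ℝ) + 1), by positivity, ?_⟩
  exact (ENNReal.toReal_lt_toReal hk.ne_top ENNReal.ofReal_ne_top).2 hk |>.trans_eq
    (ENNReal.toReal_ofReal hε.le)

/-- The overlap of the zero set of one dilate with another, nearby, dilate is of higher order. -/
theorem IsWeight.integral_zeroInd_inner_le {η κ : En n → ℝ} (h : IsWeight η κ) {M : ℝ}
    (hM : ∀ x, κ x ≤ M) (hw : LipschitzWith C w) (h0 : w 0 = 0) {τ σ δ T : ℝ} (hτ : τ ≤ 0)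
    (hT : T ≤ τ) (hδ : 2 * C * |τ - σ| ≤ δ) :
    |∫ x, zeroInd (dil w σ x) * inner ℝ (dil w τ x) x * κ x| ≤
      2 * C * |τ - σ| * M * ((Real.exp T ^ n)⁻¹ *
        volume.real {y : En n | y ∈ ball (0 : En n) 1 ∧ w y ≠ 0 ∧ ‖w y‖ ≤ δ}) := by
  set S : Set (En n) := {y : En n | y ∈ ball (0 : En n) 1 ∧ w y ≠ 0 ∧ ‖w y‖ ≤ δ} with hS
  have hM0 : 0 ≤ M := (h.kappa_nonneg 0).trans (hM 0)
  have hSm : MeasurableSet S := by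
    refine measurableSet_ball.inter (MeasurableSet.inter ?_ ?_)
    · exact (isOpen_ne_fun hw.continuous continuous_const).measurableSet
    · exact (isClosed_le hw.continuous.norm continuous_const).measurableSet
  have hSfin : volume S ≠ ⊤ :=
    ((measure_mono fun y hy => hy.1).trans_lt measure_ball_lt_top).ne
  set S' : Set (En n) := (fun x : En n => Real.exp τ • x) ⁻¹' S with hS'
  have hvol : volume S' = ENNReal.ofReal |(Real.exp τ ^ n)⁻¹| * volume S := by
    have := Measure.addHaar_preimage_smul (volume : Measure (En n)) (Real.exp_pos τ).ne' S
    rw [finrank_euclideanSpace_fin] at this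
    exact this
  have hvol' : volume.real S' = (Real.exp τ ^ n)⁻¹ * volume.real S := by
    rw [measureReal_def, hvol, ENNReal.toReal_mul, ENNReal.toReal_ofReal (abs_nonneg _),
      abs_of_nonneg (by positivity)]
    rfl
  have hS'fin : volume S' ≠ ⊤ := by
    rw [hvol]; exact ENNReal.mul_ne_top ENNReal.ofReal_ne_top hSfin
  have hS'm : MeasurableSet S' := hSm.preimage (by fun_prop)
  have hpt : ∀ x, ‖zeroInd (dil w σ x) * inner ℝ (dil w τ x) x * κ x‖ ≤
      S'.indicator (fun _ => 2 * C * |τ - σ| * M) x := by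
    intro x
    have hnn : 0 ≤ S'.indicator (fun _ => 2 * C * |τ - σ| * M) x :=
      Set.indicator_nonneg (fun _ _ => by positivity) x
    by_cases hx : x ∈ ball (0 : En n) 1
    swap
    · have hx2 : 1 ≤ ‖x‖ := by simpa using hx
      simpa [h.kappa_zero x hx2] using hnn
    by_cases hz : dil w σ x = 0
    swap
    · simpa [zeroInd_of_ne hz] using hnn
    by_cases hz' : dil w τ x = 0
    · simpa [hz'] using hnn
    have hx1 : ‖x‖ < 1 := by simpa using hx
    have hd := norm_dil_sub_dil_le hw h0 τ σ x
    rw [hz, sub_zero] at hd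
    have hd1 : ‖dil w τ x‖ ≤ 2 * C * |τ - σ| := by
      refine hd.trans ?_
      have : 0 ≤ 2 * C * |τ - σ| := by positivity
      nlinarith
    have hmem : x ∈ S' := by
      refine ⟨exp_smul_mem_ball hτ hx, fun h => hz' (by simp [dil, h]), ?_⟩
      have hwx : w (Real.exp τ • x) = Real.exp τ • dil w τ x := by
        rw [dil, smul_smul, ← Real.exp_add]; simp
      rw [hwx, norm_smul, Real.norm_of_nonneg (Real.exp_pos _).le]
      have := Real.exp_le_one_iff.2 hτ
      refine le_trans ?_ (hd1.trans hδ)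
      exact mul_le_of_le_one_left (norm_nonneg _) this
    rw [Set.indicator_of_mem hmem, hz, zeroInd_zero, one_mul, norm_mul,
      Real.norm_of_nonneg (h.kappa_nonneg x)]
    have h1 : ‖inner ℝ (dil w τ x) x‖ ≤ 2 * C * |τ - σ| := by
      refine (norm_inner_le_norm _ _).trans ?_
      nlinarith [norm_nonneg (dil w τ x), norm_nonneg x]
    exact mul_le_mul h1 (hM x) (h.kappa_nonneg x) (by positivity)
  have hi : Integrable (S'.indicator (fun _ => 2 * C * |τ - σ| * M)) :=
    (integrable_indicator_iff hS'm).2 (integrableOn_const hS'fin)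
  refine (norm_integral_le_of_norm_le hi (.of_forall hpt)).trans ?_
  rw [integral_indicator_const _ hS'm, hvol', smul_eq_mul, mul_comm]
  have : (Real.exp τ ^ n)⁻¹ ≤ (Real.exp T ^ n)⁻¹ := by
    gcongr
  gcongr

end Dilations

section RealConvexity

/-- A continuous function whose symmetric second differences are bounded below by `-o(δ²)` is
convex. -/
theorem convexOn_of_second_difference {K : ℝ → ℝ} (hK : Continuous K)
    (h : ∀ c < 0, ∀ ε > 0, ∃ δ₀ > 0, ∀ δ, 0 < δ → δ < δ₀ →
      -(ε * δ ^ 2) ≤ K (c + δ) + K (c - δ) - 2 * K c) : ConvexOn ℝ (Set.Iic 0) K := by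
  refine convexOn_of_slope_mono_adjacent (convex_Iic 0) fun {a c b} _ hb hac hcb => ?_
  simp only [Set.mem_Iic] at hb
  have hca : 0 < c - a := by linarith
  have hbc : 0 < b - c := by linarith
  rw [div_le_div_iff₀ hca hbc]
  by_contra hcon
  push Not at hcon
  set m : ℝ := (K b - K a) / (b - a) with hm
  have hmb : m * (b - a) = K b - K a := by rw [hm]; field_simp [show b - a ≠ 0 by linarith]
  set g₀ : ℝ := K c - K a - m * (c - a) with hg₀
  have hba : 0 < b - a := by linarith
  have hpos : 0 < g₀ := by
    have : 0 < g₀ * (b - a) := by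
      rw [hg₀]
      have : (K c - K a - m * (c - a)) * (b - a) =
        (K c - K a) * (b - a) - (m * (b - a)) * (c - a) := by ring
      rw [this, hmb]; nlinarith
    exact (mul_pos_iff_of_pos_right hba).1 this
  set ε : ℝ := g₀ / (2 * ((c - a) * (b - c))) with hε
  have hεpos : 0 < ε := by positivity
  have hε2 : ε * ((c - a) * (b - c)) = g₀ / 2 := by rw [hε]; field_simp
  set g : ℝ → ℝ := fun t => K t - K a - m * (t - a) + ε * ((t - a) * (t - b)) with hg
  have hgc : Continuous g := by fun_prop
  obtain ⟨x, hx, hmax⟩ := isCompact_Icc.exists_isMaxOn (Set.nonempty_Icc.2 (by linarith : a ≤ b))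
    hgc.continuousOn
  have hgx : 0 < g x := by
    have h1 : g c ≤ g x := hmax ⟨hac.le, hcb.le⟩
    have h2 : g c = g₀ - ε * ((c - a) * (b - c)) := by simp only [hg, hg₀]; ring
    rw [h2, hε2] at h1
    linarith
  have hga : g a = 0 := by simp [hg]
  have hgb : g b = 0 := by simp only [hg]; linear_combination -hmb
  have hxa : a < x := lt_of_le_of_ne hx.1 (by rintro rfl; linarith)
  have hxb : x < b := lt_of_le_of_ne hx.2 (by rintro rfl; linarith)
  obtain ⟨δ₀, hδ₀, hδ⟩ := h x (by linarith) ε hεpos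
  obtain ⟨δ, hδ1, hδ2⟩ := exists_between (show 0 < min δ₀ (min (x - a) (b - x)) from
    lt_min hδ₀ (lt_min (by linarith) (by linarith)))
  have k1 := hδ δ hδ1 (hδ2.trans_le (min_le_left _ _))
  have k2 : δ < x - a := hδ2.trans_le ((min_le_right _ _).trans (min_le_left _ _))
  have k3 : δ < b - x := hδ2.trans_le ((min_le_right _ _).trans (min_le_right _ _))
  have k4 : g (x + δ) ≤ g x := hmax ⟨by linarith, by linarith⟩
  have k5 : g (x - δ) ≤ g x := hmax ⟨by linarith, by linarith⟩
  have k6 : g (x + δ) + g (x - δ) - 2 * g x =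
      K (x + δ) + K (x - δ) - 2 * K x + 2 * (ε * δ ^ 2) := by
    simp only [hg]; ring
  have : 0 < ε * δ ^ 2 := by positivity
  linarith

theorem monotoneOn_of_second_difference {K : ℝ → ℝ} (hK : Continuous K)
    (h : ∀ c < 0, ∀ ε > 0, ∃ δ₀ > 0, ∀ δ, 0 < δ → δ < δ₀ →
      -(ε * δ ^ 2) ≤ K (c + δ) + K (c - δ) - 2 * K c)
    (hlow : ∀ ε > 0, ∀ T : ℝ, ∃ τ < T, K (τ - 1) ≤ K τ + ε) : MonotoneOn K (Set.Iic 0) := by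
  have hconv := convexOn_of_second_difference hK h
  intro s hs t ht hst
  rcases hst.eq_or_lt with rfl | hst
  · exact le_rfl
  refine le_of_forall_pos_le_add fun ε hε => ?_
  obtain ⟨τ, hτ, hKτ⟩ := hlow (ε / (t - s)) (div_pos hε (by linarith)) s
  simp only [Set.mem_Iic] at hs ht
  have h1 := hconv.slope_mono_adjacent (x := τ - 1) (y := τ) (z := s)
    (by simp only [Set.mem_Iic]; linarith) hs (by linarith) hτ
  have h2 := hconv.slope_mono_adjacent (x := τ) (y := s) (z := t)
    (by simp only [Set.mem_Iic]; linarith) ht hτ hst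
  have h3 : -(ε / (t - s)) ≤ (K t - K s) / (t - s) := by
    refine le_trans ?_ (h1.trans h2)
    have : τ - (τ - 1) = 1 := by ring
    rw [this, div_one]; linarith
  rw [← neg_div, div_le_div_iff_of_pos_right (by linarith)] at h3
  linarith

end RealConvexity

section Frequency

variable {n : ℕ} {η κ : En n → ℝ} {w : En n → En n} {C : NNReal}

theorem IsWeight.lipschitz_integral (h : IsWeight η κ) {F : ℝ → En n → ℝ} {M : ℝ}
    (hF : ∀ s, Continuous (F s))
    (hlip : ∀ s t x, ‖x‖ ≤ 1 → |F s x - F t x| ≤ M * |s - t|) :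
    Continuous fun s => ∫ x, F s x * κ x := by
  have hki : Integrable κ := by simpa using h.integrable_mul_kappa (continuous_const (y := (1 : ℝ)))
  refine LipschitzWith.continuous (K := Real.toNNReal (M * ∫ x, κ x))
    (LipschitzWith.of_dist_le_mul fun s t => ?_)
  rw [Real.dist_eq, Real.dist_eq, ← integral_sub (h.integrable_mul_kappa (hF s))
    (h.integrable_mul_kappa (hF t))]
  have h1 : ‖∫ x, (F s x * κ x - F t x * κ x)‖ ≤ ∫ x, M * |s - t| * κ x := by
    refine norm_integral_le_of_norm_le (hki.const_mul _) (.of_forall fun x => ?_)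
    by_cases hx : ‖x‖ ≤ 1
    · rw [← sub_mul, norm_mul, Real.norm_of_nonneg (h.kappa_nonneg x)]
      exact mul_le_mul_of_nonneg_right (hlip s t x hx) (h.kappa_nonneg x)
    · simp [h.kappa_zero x (le_of_not_ge hx)]
  rw [integral_const_mul] at h1
  refine h1.trans ?_
  have h2 := mul_le_mul_of_nonneg_right (Real.le_coe_toNNReal (M * ∫ x, κ x)) (abs_nonneg (s - t))
  linarith

/-- The weighted mass deficit, equal to the weighted measure of the zero set of `dil w τ`. -/
def deficit (η κ : En n → ℝ) (w : En n → En n) (τ : ℝ) : ℝ :=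
  (∫ x, η x) - ∫ x, inner ℝ (dil w τ x) x * κ x

/-- The weighted energy of `dil w τ`. -/
def energy (κ : En n → ℝ) (w : En n → En n) (τ : ℝ) : ℝ :=
  ∫ x, inner ℝ (dil w τ x) (dil w τ x) * κ x

/-- The primitive of the deficit. -/
def deficitInt (η κ : En n → ℝ) (w : En n → En n) (τ : ℝ) : ℝ :=
  ∫ s in (0 : ℝ)..τ, deficit η κ w s

/-- The monotone quantity. -/
def adjEnergy (η κ : En n → ℝ) (w : En n → En n) (τ : ℝ) : ℝ :=
  energy κ w τ - 2 * deficitInt η κ w τ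

theorem continuous_dil (hw : LipschitzWith C w) (τ : ℝ) : Continuous (dil w τ) :=
  (dil_lipschitzWith hw τ).continuous

theorem abs_inner_dil_sub_le (hw : LipschitzWith C w) (h0 : w 0 = 0) (v : En n) (s t : ℝ)
    {x : En n} (hx : ‖x‖ ≤ 1) :
    |inner ℝ (dil w s x) v - inner ℝ (dil w t x) v| ≤ 2 * C * ‖v‖ * |s - t| := by
  rw [← inner_sub_left]
  refine (abs_real_inner_le_norm _ _).trans ?_
  have h1 := norm_dil_sub_dil_le hw h0 s t x
  have h2 : 2 * C * ‖x‖ * |s - t| ≤ 2 * C * |s - t| := by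
    have : 0 ≤ 2 * C * |s - t| := by positivity
    nlinarith
  calc ‖dil w s x - dil w t x‖ * ‖v‖ ≤ (2 * C * |s - t|) * ‖v‖ := by
        gcongr; exact h1.trans h2
    _ = _ := by ring

theorem abs_inner_dil_dil_sub_le (hw : LipschitzWith C w) (h0 : w 0 = 0) (s t s' t' : ℝ)
    {x : En n} (hx : ‖x‖ ≤ 1) :
    |inner ℝ (dil w s x) (dil w s' x) - inner ℝ (dil w t x) (dil w t' x)| ≤
      2 * C ^ 2 * (|s - t| + |s' - t'|) := by
  have hb : ∀ r, ‖dil w r x‖ ≤ C := fun r => (norm_dil_le hw h0 r x).trans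
    (mul_le_of_le_one_right C.2 hx)
  have h1 := abs_inner_dil_sub_le hw h0 (dil w s' x) s t hx
  have h2 := abs_inner_dil_sub_le hw h0 (dil w t x) s' t' hx
  have h3 : inner ℝ (dil w s x) (dil w s' x) - inner ℝ (dil w t x) (dil w t' x) =
      (inner ℝ (dil w s x) (dil w s' x) - inner ℝ (dil w t x) (dil w s' x)) +
      (inner ℝ (dil w s' x) (dil w t x) - inner ℝ (dil w t' x) (dil w t x)) := by
    rw [real_inner_comm (dil w t x) (dil w s' x), real_inner_comm (dil w t x) (dil w t' x)]; ring
  rw [h3]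
  refine (abs_add_le _ _).trans ?_
  have h4 : 2 * C * ‖dil w s' x‖ * |s - t| ≤ 2 * C * C * |s - t| := by gcongr; exact hb _
  have h5 : 2 * C * ‖dil w t x‖ * |s' - t'| ≤ 2 * C * C * |s' - t'| := by gcongr; exact hb _
  linarith

theorem continuous_deficit (h : IsWeight η κ) (hw : LipschitzWith C w) (h0 : w 0 = 0) :
    Continuous (deficit η κ w) := by
  refine continuous_const.sub (h.lipschitz_integral (M := 2 * C)
    (fun s => (continuous_dil hw s).inner continuous_id) fun s t x hx => ?_)
  refine (abs_inner_dil_sub_le hw h0 x s t hx).trans ?_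
  have : 0 ≤ 2 * C * |s - t| := by positivity
  nlinarith

theorem continuous_energy (h : IsWeight η κ) (hw : LipschitzWith C w) (h0 : w 0 = 0) :
    Continuous (energy κ w) := by
  refine h.lipschitz_integral (M := 4 * C ^ 2)
    (fun s => (continuous_dil hw s).inner (continuous_dil hw s)) fun s t x hx => ?_
  refine (abs_inner_dil_dil_sub_le hw h0 s t s t hx).trans (le_of_eq ?_)
  ring

theorem hasDerivAt_deficitInt (h : IsWeight η κ) (hw : LipschitzWith C w) (h0 : w 0 = 0) (τ : ℝ) :
    HasDerivAt (deficitInt η κ w) (deficit η κ w τ) τ :=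
  intervalIntegral.integral_hasDerivAt_right
    ((continuous_deficit h hw h0).intervalIntegrable _ _)
    ((continuous_deficit h hw h0).stronglyMeasurableAtFilter _ _)
    (continuous_deficit h hw h0).continuousAt

theorem continuous_adjEnergy (h : IsWeight η κ) (hw : LipschitzWith C w) (h0 : w 0 = 0) :
    Continuous (adjEnergy η κ w) :=
  (continuous_energy h hw h0).sub (continuous_const.mul (continuous_iff_continuousAt.2 fun τ =>
    (hasDerivAt_deficitInt h hw h0 τ).continuousAt))

theorem integrable_zeroInd_mul (h : IsWeight η κ) (hw : LipschitzWith C w) (τ : ℝ)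
    {g : En n → ℝ} (hg : Continuous g) :
    Integrable fun x => zeroInd (dil w τ x) * g x * κ x := by
  have := (h.integrable_mul_kappa hg).bdd_mul (c := 1) (f := fun x => zeroInd (dil w τ x))
    (measurable_zeroInd.comp (continuous_dil hw τ).measurable).aestronglyMeasurable
    (.of_forall fun x => by
      rw [Real.norm_of_nonneg (zeroInd_nonneg _)]; exact zeroInd_le_one _)
  refine this.congr (.of_forall fun x => ?_)
  simp only; ring

theorem deficit_eq (h : IsWeight η κ) (hw : IsGradField w fun x => 1 - zeroInd (w x)) {τ : ℝ}
    (hτ : τ ≤ 0) : Integrable (fun x => zeroInd (dil w τ x) * η x) ∧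
      deficit η κ w τ = ∫ x, zeroInd (dil w τ x) * η x := by
  obtain ⟨hi, he⟩ := (hw.dil hτ).integral_mul_eta h
  have hηi : Integrable η := h.continuous_eta.integrable_of_hasCompactSupport
    h.hasCompactSupport_eta
  have heq : (fun x => zeroInd (dil w τ x) * η x) =
      fun x => η x - (1 - zeroInd (dil w τ x)) * η x := by funext x; ring
  rw [heq]
  refine ⟨hηi.sub hi, ?_⟩
  rw [integral_sub hηi hi, he, deficit]

theorem deficit_nonneg (h : IsWeight η κ) (hw : IsGradField w fun x => 1 - zeroInd (w x)) {τ : ℝ}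
    (hτ : τ ≤ 0) : 0 ≤ deficit η κ w τ := by
  rw [(deficit_eq h hw hτ).2]
  exact integral_nonneg fun x => mul_nonneg (zeroInd_nonneg _) (h.eta_nonneg x)

theorem ae_differentiableAt_exp_smul (hw : LipschitzWith C w) (τ : ℝ) :
    ∀ᵐ x : En n, DifferentiableAt ℝ w (Real.exp τ • x) :=
  ae_exp_smul hw.ae_differentiableAt τ

theorem hasDerivAt_cross (h : IsWeight η κ) (hw : LipschitzWith C w) (h0 : w 0 = 0)
    (hg : IsGradField w fun x => 1 - zeroInd (w x)) {c s : ℝ} (h1 : c - s ≤ 0) (h2 : c + s ≤ 0) :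
    HasDerivAt (fun s => ∫ x, inner ℝ (dil w (c - s) x) (dil w (c + s) x) * κ x)
      (deficit η κ w (c + s) - deficit η κ w (c - s) -
        (∫ x, zeroInd (dil w (c + s) x) * inner ℝ (dil w (c - s) x) x * κ x) +
        ∫ x, zeroInd (dil w (c - s) x) * inner ℝ (dil w (c + s) x) x * κ x) s := by
  have hd := h.hasDerivAt_integral (s₀ := s) (M := 4 * C ^ 2)
    (F := fun s x => inner ℝ (dil w (c - s) x) (dil w (c + s) x))
    (F' := fun x => inner ℝ (dil w (c - s) x) (fderiv ℝ (dil w (c + s)) x x) -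
      inner ℝ (dil w (c + s) x) (fderiv ℝ (dil w (c - s)) x x)) (by positivity)
    (fun s => (continuous_dil hw _).inner (continuous_dil hw _)) (fun s t x hx => ?_) ?_
  · refine hd.congr_deriv ?_
    rw [(hg.dil h1).integral_inner_fderiv_sub h (hg.dil h2)]
    have ca := continuous_dil hw (c - s)
    have cb := continuous_dil hw (c + s)
    have i1 := h.integrable_mul_kappa (ca.inner continuous_id)
    have i2 := h.integrable_mul_kappa (cb.inner continuous_id)
    have i3 := integrable_zeroInd_mul h hw (c + s) (ca.inner continuous_id)
    have i4 := integrable_zeroInd_mul h hw (c - s) (cb.inner continuous_id)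
    simp only [id] at i1 i2 i3 i4
    have i12 : Integrable fun x => inner ℝ (dil w (c - s) x) x * κ x -
        inner ℝ (dil w (c + s) x) x * κ x := i1.sub i2
    have i123 : Integrable fun x => inner ℝ (dil w (c - s) x) x * κ x -
        inner ℝ (dil w (c + s) x) x * κ x -
        zeroInd (dil w (c + s) x) * inner ℝ (dil w (c - s) x) x * κ x := i12.sub i3
    have heq : (fun x => ((1 - zeroInd (dil w (c + s) x)) * inner ℝ (dil w (c - s) x) x -
        (1 - zeroInd (dil w (c - s) x)) * inner ℝ (dil w (c + s) x) x) * κ x) =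
      fun x => inner ℝ (dil w (c - s) x) x * κ x - inner ℝ (dil w (c + s) x) x * κ x -
        zeroInd (dil w (c + s) x) * inner ℝ (dil w (c - s) x) x * κ x +
        zeroInd (dil w (c - s) x) * inner ℝ (dil w (c + s) x) x * κ x := by
      funext x; ring
    rw [heq, integral_add i123 i4, integral_sub i12 i3,
      integral_sub i1 i2, deficit, deficit]
    ring
  · refine (abs_inner_dil_dil_sub_le hw h0 _ _ _ _ hx).trans (le_of_eq ?_)
    rw [show c - s - (c - t) = -(s - t) by ring, show c + s - (c + t) = s - t by ring, abs_neg]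
    ring
  · filter_upwards [ae_differentiableAt_exp_smul hw (c - s),
      ae_differentiableAt_exp_smul hw (c + s)] with x hx1 hx2
    have e1 : HasDerivAt (fun s => dil w (c - s) x)
        (-(fderiv ℝ (dil w (c - s)) x x - dil w (c - s) x)) s :=
      (hasDerivAt_dil hx1).comp_const_sub c s
    have e2 : HasDerivAt (fun s => dil w (c + s) x)
        (fderiv ℝ (dil w (c + s)) x x - dil w (c + s) x) s :=
      (hasDerivAt_dil hx2).comp_const_add c s
    refine (e1.inner ℝ e2).congr_deriv ?_
    rw [inner_sub_right, inner_neg_left, inner_sub_left,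
      real_inner_comm (fderiv ℝ (dil w (c - s)) x x) (dil w (c + s) x)]
    ring

theorem adjEnergy_second_difference (h : IsWeight η κ) (hw : LipschitzWith C w) (h0 : w 0 = 0)
    (hg : IsGradField w fun x => 1 - zeroInd (w x)) {c : ℝ} (hc : c < 0) {ε : ℝ} (hε : 0 < ε) :
    ∃ δ₀ > 0, ∀ δ, 0 < δ → δ < δ₀ → -(ε * δ ^ 2) ≤
      adjEnergy η κ w (c + δ) + adjEnergy η κ w (c - δ) - 2 * adjEnergy η κ w c := by
  obtain ⟨M, hM0, -, hM⟩ := h.exists_bound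
  set Q : ℝ := (Real.exp (2 * c) ^ n)⁻¹ with hQ
  have hQ0 : 0 < Q := by positivity
  obtain ⟨ρ, hρ, hvol⟩ := exists_measureReal_small hw.continuous
    (show 0 < ε / (16 * C * M * Q + 1) by positivity)
  set v : ℝ := volume.real {y : En n | y ∈ ball (0 : En n) 1 ∧ w y ≠ 0 ∧ ‖w y‖ ≤ ρ} with hv
  have hv0 : 0 ≤ v := measureReal_nonneg
  have hvε : 16 * C * M * Q * v ≤ ε := by
    rw [lt_div_iff₀ (by positivity)] at hvol
    nlinarith
  refine ⟨min (-c) (ρ / (4 * C + 1)), lt_min (by linarith) (by positivity), fun δ hδ0 hδ => ?_⟩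
  have hδc : δ < -c := hδ.trans_le (min_le_left _ _)
  have hδρ : 4 * C * δ ≤ ρ := by
    have := hδ.trans_le (min_le_right _ _)
    rw [lt_div_iff₀ (by positivity)] at this
    nlinarith
  set G : ℝ → ℝ := fun s => 2 * (∫ x, inner ℝ (dil w (c - s) x) (dil w (c + s) x) * κ x) -
    2 * deficitInt η κ w (c + s) - 2 * deficitInt η κ w (c - s) with hG
  set E : ℝ → ℝ := fun s =>
    -(∫ x, zeroInd (dil w (c + s) x) * inner ℝ (dil w (c - s) x) x * κ x) +
        ∫ x, zeroInd (dil w (c - s) x) * inner ℝ (dil w (c + s) x) x * κ x with hE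
  have hderiv : ∀ s ∈ Set.Icc 0 δ, HasDerivWithinAt G (2 * E s) (Set.Icc 0 δ) s := by
    intro s hs
    have d1 := hasDerivAt_cross h hw h0 hg (c := c) (s := s) (by linarith [hs.1])
      (by linarith [hs.2])
    have d2 : HasDerivAt (fun s => deficitInt η κ w (c + s)) (deficit η κ w (c + s)) s :=
      (hasDerivAt_deficitInt h hw h0 (c + s)).comp_const_add c s
    have d3 : HasDerivAt (fun s => deficitInt η κ w (c - s)) (-deficit η κ w (c - s)) s :=
      (hasDerivAt_deficitInt h hw h0 (c - s)).comp_const_sub c s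
    refine HasDerivAt.hasDerivWithinAt ((((d1.const_mul 2).sub (d2.const_mul 2)).sub
      (d3.const_mul 2)).congr_deriv ?_)
    simp only [hE]; ring
  have hbound : ∀ s ∈ Set.Ico 0 δ, ‖2 * E s‖ ≤ ε * δ := by
    intro s hs
    have hs0 := hs.1
    have a1 : |c - s - (c + s)| = 2 * s := by
      rw [show c - s - (c + s) = -(2 * s) by ring, abs_neg, abs_of_nonneg (by linarith)]
    have a2 : |c + s - (c - s)| = 2 * s := by
      rw [show c + s - (c - s) = 2 * s by ring, abs_of_nonneg (by linarith)]
    have hsρ : 2 * C * (2 * s) ≤ ρ := by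
      have := mul_le_mul_of_nonneg_left hs.2.le (show 0 ≤ (4 * C : ℝ) by positivity)
      linarith
    have b1 := h.integral_zeroInd_inner_le hM hw h0 (τ := c - s) (σ := c + s) (δ := ρ)
      (T := 2 * c) (by linarith) (by linarith [hs.2]) (by rw [a1]; exact hsρ)
    have b2 := h.integral_zeroInd_inner_le hM hw h0 (τ := c + s) (σ := c - s) (δ := ρ)
      (T := 2 * c) (by linarith [hs.2]) (by linarith) (by rw [a2]; exact hsρ)
    rw [a1] at b1
    rw [a2] at b2
    rw [norm_mul, Real.norm_of_nonneg (by norm_num : (0 : ℝ) ≤ 2)]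
    have b3 : |E s| ≤ 8 * C * M * Q * v * s := by
      simp only [hE]
      refine (abs_add_le _ _).trans ?_
      rw [abs_neg]
      calc _ ≤ 2 * C * (2 * s) * M * (Q * v) + 2 * C * (2 * s) * M * (Q * v) := add_le_add b1 b2
        _ = _ := by ring
    calc 2 * ‖E s‖ ≤ 2 * (8 * C * M * Q * v * s) := by gcongr; exact b3
      _ = (16 * C * M * Q * v) * s := by ring
      _ ≤ ε * δ := by
        have := hs.2.le
        gcongr
  have hmv := norm_image_sub_le_of_norm_deriv_le_segment' hderiv hbound δ ⟨hδ0.le, le_rfl⟩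
  rw [Real.norm_eq_abs] at hmv
  have hmv' := (abs_le.1 hmv).1
  have hG0 : G 0 = 2 * adjEnergy η κ w c := by
    simp only [hG, adjEnergy, energy, sub_zero, add_zero]; ring
  have ca := continuous_dil hw (c - δ)
  have cb := continuous_dil hw (c + δ)
  have hsq : 0 ≤ energy κ w (c + δ) + energy κ w (c - δ) -
      2 * ∫ x, inner ℝ (dil w (c - δ) x) (dil w (c + δ) x) * κ x := by
    have i1 := h.integrable_mul_kappa (cb.inner cb (𝕜 := ℝ))
    have i2 := h.integrable_mul_kappa (ca.inner ca (𝕜 := ℝ))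
    have i3 := h.integrable_mul_kappa (ca.inner cb (𝕜 := ℝ))
    rw [energy, energy, ← integral_add i1 i2, ← integral_const_mul,
      ← integral_sub (i1.fun_add i2) (i3.const_mul 2)]
    refine integral_nonneg fun x => ?_
    have e : inner ℝ (dil w (c + δ) x) (dil w (c + δ) x) * κ x +
      inner ℝ (dil w (c - δ) x) (dil w (c - δ) x) * κ x -
      2 * (inner ℝ (dil w (c - δ) x) (dil w (c + δ) x) * κ x) =
      inner ℝ (dil w (c - δ) x - dil w (c + δ) x) (dil w (c - δ) x - dil w (c + δ) x) * κ x := by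
      rw [real_inner_sub_sub_self]; ring
    exact (mul_nonneg real_inner_self_nonneg (h.kappa_nonneg x)).trans_eq e.symm
  have hGδ : G δ ≤ adjEnergy η κ w (c + δ) + adjEnergy η κ w (c - δ) := by
    simp only [hG, adjEnergy]; linarith
  nlinarith

end Frequency

section Limits

variable {n : ℕ} {η κ η' κ' : En n → ℝ} {w : En n → En n} {C : NNReal} {A : En n →L[ℝ] En n}

theorem exists_tendsto_atBot_of_monotoneOn {f : ℝ → ℝ} (hf : MonotoneOn f (Set.Iic 0)) {b : ℝ}
    (hb : ∀ τ ≤ 0, b ≤ f τ) : ∃ l, Tendsto f atBot (𝓝 l) := by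
  have hmono : Monotone fun τ => f (min τ 0) := fun s t hst =>
    hf (Set.mem_Iic.2 (min_le_right _ _)) (Set.mem_Iic.2 (min_le_right _ _))
      (min_le_min_right 0 hst)
  refine ⟨_, (tendsto_atBot_ciInf hmono ⟨b, ?_⟩).congr' ?_⟩
  · rintro _ ⟨τ, rfl⟩
    exact hb _ (min_le_right _ _)
  · filter_upwards [eventually_le_atBot 0] with τ hτ
    rw [min_eq_left hτ]

theorem monotoneOn_Iic_of_hasDerivAt {f f' : ℝ → ℝ} (hf : ∀ τ ≤ 0, HasDerivAt f (f' τ) τ)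
    (hf' : ∀ τ ≤ 0, 0 ≤ f' τ) : MonotoneOn f (Set.Iic 0) := by
  refine monotoneOn_of_hasDerivWithinAt_nonneg (convex_Iic 0)
    (fun τ hτ => (hf τ hτ).continuousAt.continuousWithinAt)
    (fun τ hτ => (hf τ (Set.mem_Iic.1 (interior_subset hτ))).hasDerivWithinAt)
    fun τ hτ => hf' τ (Set.mem_Iic.1 (interior_subset hτ))

theorem IsWeight.integrable_kappa (h : IsWeight η κ) : Integrable κ := by
  simpa using h.integrable_mul_kappa (continuous_const (y := (1 : ℝ)))

theorem IsWeight.abs_integral_le (h : IsWeight η κ) {g : En n → ℝ} {M : ℝ}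
    (hg : ∀ x, ‖x‖ ≤ 1 → |g x| ≤ M) : |∫ x, g x * κ x| ≤ M * ∫ x, κ x := by
  rw [← integral_const_mul, ← Real.norm_eq_abs]
  refine norm_integral_le_of_norm_le (h.integrable_kappa.const_mul _) (.of_forall fun x => ?_)
  by_cases hx : ‖x‖ ≤ 1
  · rw [norm_mul, Real.norm_of_nonneg (h.kappa_nonneg x)]
    exact mul_le_mul_of_nonneg_right (hg x hx) (h.kappa_nonneg x)
  · simp [h.kappa_zero x (le_of_not_ge hx)]

theorem isGradField_clm (hA : ∀ v w, inner ℝ (A v) w = inner ℝ (A w) v)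
    (hA1 : LinearMap.trace ℝ (En n) (A : En n →ₗ[ℝ] En n) = 1) : IsGradField A fun _ => 1 :=
  ⟨⟨_, A.lipschitz⟩, .of_forall fun x _ => by
    rw [A.fderiv]; exact ⟨A.differentiableAt, hA, hA1⟩⟩

theorem norm_dil_shift_sub_le {τ s ε : ℝ} (hs : 0 ≤ s) (hs1 : s ≤ 1)
    (h : ∀ x, ‖x‖ ≤ 1 → ‖dil w τ x - A x‖ ≤ ε) {x : En n} (hx : ‖x‖ ≤ 1) :
    ‖dil w (τ - s) x - A x‖ ≤ 3 * ε := by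
  have e1 : Real.exp s * Real.exp (-s) = 1 := by rw [← Real.exp_add]; simp
  have e2 : dil w (τ - s) x - A x =
      Real.exp s • (dil w τ (Real.exp (-s) • x) - A (Real.exp (-s) • x)) := by
    rw [smul_sub, map_smul, smul_smul, e1, one_smul, dil, dil, smul_smul, smul_smul,
      ← Real.exp_add, ← Real.exp_add]
    congr 4; ring
  have hx' : ‖Real.exp (-s) • x‖ ≤ 1 := by
    rw [norm_smul, Real.norm_of_nonneg (Real.exp_pos _).le]
    have : Real.exp (-s) ≤ 1 := Real.exp_le_one_iff.2 (by linarith)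
    nlinarith [norm_nonneg x, Real.exp_pos (-s)]
  have h1 := h _ hx'
  rw [e2, norm_smul, Real.norm_of_nonneg (Real.exp_pos _).le]
  have h3 : Real.exp s ≤ 3 := (Real.exp_le_exp.2 hs1).trans Real.exp_one_lt_three.le
  exact mul_le_mul h3 h1 (norm_nonneg _) (by norm_num)

/-- `dil w τ` is close to `A` on the unit ball for arbitrarily negative `τ`. -/
def IsBlowup (w : En n → En n) (A : En n →L[ℝ] En n) : Prop :=
  ∀ ε > 0, ∀ T : ℝ, ∃ τ < T, ∀ x, ‖x‖ ≤ 1 → ‖dil w τ x - A x‖ ≤ ε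

theorem adjEnergy_almost_mono (h : IsWeight η κ) (hw : LipschitzWith C w) (h0 : w 0 = 0)
    (hA : IsGradField A fun _ => 1) (hb : IsBlowup w A) {ε : ℝ} (hε : 0 < ε) (T : ℝ) :
    ∃ τ < T, adjEnergy η κ w (τ - 1) ≤ adjEnergy η κ w τ + ε := by
  set k : ℝ := ∫ x, κ x with hk
  have hk0 : 0 ≤ k := integral_nonneg h.kappa_nonneg
  obtain ⟨τ, hτ, hcl⟩ := hb (ε / ((8 * C + 6) * k + 1)) (by positivity) T
  set ε₀ : ℝ := ε / ((8 * C + 6) * k + 1) with hε₀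
  have hε₀0 : 0 < ε₀ := by positivity
  have hεε : (8 * C + 6) * k * ε₀ ≤ ε := by
    have : ((8 * C + 6) * k + 1) * ε₀ = ε := by rw [hε₀]; field_simp
    nlinarith
  refine ⟨τ, hτ, ?_⟩
  have hE : |energy κ w (τ - 1) - energy κ w τ| ≤ 8 * C * ε₀ * k := by
    have c1 := continuous_dil hw (τ - 1)
    have c2 := continuous_dil hw τ
    rw [energy, energy, ← integral_sub (h.integrable_mul_kappa (c1.inner c1))
      (h.integrable_mul_kappa (c2.inner c2))]
    simp only [← sub_mul]
    refine h.abs_integral_le fun x hx => ?_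
    set a := dil w (τ - 1) x with ha
    set b := dil w τ x with hb'
    have n1 : ‖a‖ ≤ C := (norm_dil_le hw h0 _ x).trans (mul_le_of_le_one_right C.2 hx)
    have n2 : ‖b‖ ≤ C := (norm_dil_le hw h0 _ x).trans (mul_le_of_le_one_right C.2 hx)
    have n3 : ‖a - b‖ ≤ 4 * ε₀ := by
      have q1 := norm_dil_shift_sub_le (A := A) zero_le_one le_rfl hcl hx
      have q2 := hcl x hx
      have : a - b = (a - A x) - (b - A x) := by abel
      rw [this]
      exact (norm_sub_le _ _).trans (by linarith)
    have e : inner ℝ a a - inner ℝ b b = inner ℝ (a - b) (a + b) := by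
      rw [inner_sub_left, inner_add_right, inner_add_right, real_inner_comm a b]; ring
    rw [e]
    refine (abs_real_inner_le_norm _ _).trans ?_
    calc ‖a - b‖ * ‖a + b‖ ≤ (4 * ε₀) * (C + C) := by
          gcongr
          exact (norm_add_le _ _).trans (by linarith)
      _ = _ := by ring
  have hD : ∀ σ ∈ Set.Ioo (τ - 1) τ, deficit η κ w σ ≤ 3 * ε₀ * k := by
    intro σ hσ
    have hη := (hA.integral_mul_eta h).2
    simp only [one_mul] at hη
    have c1 := continuous_dil hw σ
    have i1 := h.integrable_mul_kappa (A.continuous.inner continuous_id)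
    have i2 := h.integrable_mul_kappa (c1.inner continuous_id)
    simp only [id] at i1 i2
    rw [deficit, hη, ← integral_sub i1 i2]
    simp only [← sub_mul, ← inner_sub_left]
    refine (le_abs_self _).trans (h.abs_integral_le fun x hx => ?_)
    refine (abs_real_inner_le_norm _ _).trans ?_
    have q := norm_dil_shift_sub_le (A := A) (τ := τ) (s := τ - σ) (by linarith [hσ.2])
      (by linarith [hσ.1]) hcl hx
    rw [sub_sub_cancel, norm_sub_rev] at q
    exact (mul_le_of_le_one_right (norm_nonneg _) hx).trans q
  obtain ⟨σ, hσ, hslope⟩ := exists_hasDerivAt_eq_slope (deficitInt η κ w) (deficit η κ w)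
    (show τ - 1 < τ by linarith)
    (fun s _ => (hasDerivAt_deficitInt h hw h0 s).continuousAt.continuousWithinAt)
    fun s _ => hasDerivAt_deficitInt h hw h0 s
  rw [sub_sub_cancel, div_one] at hslope
  have := hD σ hσ
  rw [hslope] at this
  have hE' := (abs_le.1 hE).2
  rw [adjEnergy, adjEnergy]
  nlinarith

theorem adjEnergy_monotoneOn (h : IsWeight η κ) (hw : LipschitzWith C w) (h0 : w 0 = 0)
    (hg : IsGradField w fun x => 1 - zeroInd (w x)) (hA : IsGradField A fun _ => 1)
    (hb : IsBlowup w A) : MonotoneOn (adjEnergy η κ w) (Set.Iic 0) :=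
  monotoneOn_of_second_difference (continuous_adjEnergy h hw h0)
    (fun _ hc _ hε => adjEnergy_second_difference h hw h0 hg hc hε)
    fun _ hε T => adjEnergy_almost_mono h hw h0 hA hb hε T

theorem deficitInt_monotoneOn (h : IsWeight η κ) (hw : LipschitzWith C w) (h0 : w 0 = 0)
    (hg : IsGradField w fun x => 1 - zeroInd (w x)) : MonotoneOn (deficitInt η κ w) (Set.Iic 0) :=
  monotoneOn_Iic_of_hasDerivAt (fun τ _ => hasDerivAt_deficitInt h hw h0 τ)
    fun _ hτ => deficit_nonneg h hg hτ

theorem energy_nonneg (h : IsWeight η κ) (τ : ℝ) : 0 ≤ energy κ w τ :=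
  integral_nonneg fun x => mul_nonneg real_inner_self_nonneg (h.kappa_nonneg x)

theorem deficitInt_lower_bound (h : IsWeight η κ) (hw : LipschitzWith C w) (h0 : w 0 = 0)
    (hg : IsGradField w fun x => 1 - zeroInd (w x)) (hA : IsGradField A fun _ => 1)
    (hb : IsBlowup w A) {τ : ℝ} (hτ : τ ≤ 0) : -(energy κ w 0 / 2) ≤ deficitInt η κ w τ := by
  have h1 := adjEnergy_monotoneOn h hw h0 hg hA hb (show τ ∈ Set.Iic 0 from hτ)
    (show (0 : ℝ) ∈ Set.Iic 0 from Set.mem_Iic.2 le_rfl) hτ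
  have h2 : deficitInt η κ w 0 = 0 := by simp [deficitInt]
  rw [adjEnergy, adjEnergy, h2] at h1
  linarith [energy_nonneg h τ (w := w)]

theorem exists_tendsto_deficitInt (h : IsWeight η κ) (hw : LipschitzWith C w) (h0 : w 0 = 0)
    (hg : IsGradField w fun x => 1 - zeroInd (w x)) (hA : IsGradField A fun _ => 1)
    (hb : IsBlowup w A) : ∃ l, Tendsto (deficitInt η κ w) atBot (𝓝 l) :=
  exists_tendsto_atBot_of_monotoneOn (deficitInt_monotoneOn h hw h0 hg)
    fun _ hτ => deficitInt_lower_bound h hw h0 hg hA hb hτ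

theorem exists_tendsto_energy (h : IsWeight η κ) (hw : LipschitzWith C w) (h0 : w 0 = 0)
    (hg : IsGradField w fun x => 1 - zeroInd (w x)) (hA : IsGradField A fun _ => 1)
    (hb : IsBlowup w A) : ∃ l, Tendsto (energy κ w) atBot (𝓝 l) := by
  obtain ⟨l, hl⟩ := exists_tendsto_deficitInt h hw h0 hg hA hb
  have h2 : deficitInt η κ w 0 = 0 := by simp [deficitInt]
  obtain ⟨m, hm⟩ := exists_tendsto_atBot_of_monotoneOn (b := 0)
    (adjEnergy_monotoneOn h hw h0 hg hA hb) fun τ hτ => by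
      have h1 := deficitInt_monotoneOn h hw h0 hg (show τ ∈ Set.Iic 0 from hτ)
        (show (0 : ℝ) ∈ Set.Iic 0 from Set.mem_Iic.2 le_rfl) hτ
      rw [adjEnergy]
      linarith [energy_nonneg h τ (w := w)]
  refine ⟨m + 2 * l, (hm.add (hl.const_mul 2)).congr fun τ => ?_⟩
  rw [adjEnergy]; ring

theorem hasDerivAt_cross_clm (h : IsWeight η κ) (hw : LipschitzWith C w) (h0 : w 0 = 0)
    (hg : IsGradField w fun x => 1 - zeroInd (w x)) (hA : IsGradField A fun _ => 1) {τ : ℝ}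
    (hτ : τ ≤ 0) : HasDerivAt (fun τ => ∫ x, inner ℝ (A x) (dil w τ x) * κ x)
      (deficit η κ w τ - ∫ x, zeroInd (dil w τ x) * inner ℝ (A x) x * κ x) τ := by
  have hd := h.hasDerivAt_integral (s₀ := τ) (M := 2 * C * ‖A‖)
    (F := fun s x => inner ℝ (A x) (dil w s x))
    (F' := fun x => inner ℝ (A x) (fderiv ℝ (dil w τ) x x) -
      inner ℝ (dil w τ x) (fderiv ℝ A x x)) (by positivity)
    (fun s => A.continuous.inner (continuous_dil hw _)) (fun s t x hx => ?_) ?_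
  · refine hd.congr_deriv ?_
    rw [hA.integral_inner_fderiv_sub h (hg.dil hτ)]
    have cb := continuous_dil hw τ
    have i1 := h.integrable_mul_kappa (A.continuous.inner continuous_id)
    have i2 := h.integrable_mul_kappa (cb.inner continuous_id)
    have i3 := integrable_zeroInd_mul h hw τ (A.continuous.inner continuous_id)
    simp only [id] at i1 i2 i3
    have i12 : Integrable fun x => inner ℝ (A x) x * κ x - inner ℝ (dil w τ x) x * κ x := i1.sub i2
    have heq : (fun x => ((1 - zeroInd (dil w τ x)) * inner ℝ (A x) x -
        1 * inner ℝ (dil w τ x) x) * κ x) =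
      fun x => inner ℝ (A x) x * κ x - inner ℝ (dil w τ x) x * κ x -
        zeroInd (dil w τ x) * inner ℝ (A x) x * κ x := by
      funext x; ring
    have hη := (hA.integral_mul_eta h).2
    simp only [one_mul] at hη
    rw [heq, integral_sub i12 i3, integral_sub i1 i2, deficit, hη]
  · have := abs_inner_dil_sub_le hw h0 (A x) s t hx
    rw [real_inner_comm (A x), real_inner_comm (A x)] at this
    refine this.trans ?_
    have hAx : ‖A x‖ ≤ ‖A‖ := (A.le_opNorm x).trans (mul_le_of_le_one_right (norm_nonneg _) hx)
    gcongr
  · filter_upwards [ae_differentiableAt_exp_smul hw τ] with x hx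
    refine ((hasDerivAt_const τ (A x)).inner ℝ (hasDerivAt_dil hx)).congr_deriv ?_
    rw [A.fderiv, inner_zero_left, inner_sub_right, real_inner_comm (A x)]
    ring

theorem exists_tendsto_cross (h : IsWeight η κ) (h' : IsWeight η' κ') (hη : ∀ x, η x ≤ η' x)
    {c : ℝ} (hκ : ∀ x, κ x ≤ c * η' x) (hc : 0 ≤ c)
    (hw : LipschitzWith C w) (h0 : w 0 = 0)
    (hg : IsGradField w fun x => 1 - zeroInd (w x)) (hA : IsGradField A fun _ => 1)
    (hb : IsBlowup w A) :
    ∃ l, Tendsto (fun τ => ∫ x, inner ℝ (A x) (dil w τ x) * κ x) atBot (𝓝 l) := by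
  set D : ℝ := 1 + ‖A‖ * c with hD
  have hbound : ∀ τ ≤ 0, |deficit η κ w τ - ∫ x, zeroInd (dil w τ x) * inner ℝ (A x) x * κ x| ≤
      D * deficit η' κ' w τ := by
    intro τ hτ
    obtain ⟨i1, e1⟩ := deficit_eq h hg hτ
    obtain ⟨i2, e2⟩ := deficit_eq h' hg hτ
    have b1 : |deficit η κ w τ| ≤ deficit η' κ' w τ := by
      rw [abs_of_nonneg (deficit_nonneg h hg hτ), e1, e2]
      exact integral_mono i1 i2 fun x => mul_le_mul_of_nonneg_left (hη x) (zeroInd_nonneg _)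
    have b2 : |∫ x, zeroInd (dil w τ x) * inner ℝ (A x) x * κ x| ≤
        ‖A‖ * c * deficit η' κ' w τ := by
      rw [e2, ← integral_const_mul, ← Real.norm_eq_abs]
      refine norm_integral_le_of_norm_le (i2.const_mul _) (.of_forall fun x => ?_)
      have hz := zeroInd_nonneg (dil w τ x)
      by_cases hx : ‖x‖ ≤ 1
      · rw [norm_mul, norm_mul, Real.norm_of_nonneg hz, Real.norm_of_nonneg (h.kappa_nonneg x)]
        have hAx : ‖inner ℝ (A x) x‖ ≤ ‖A‖ := by
          refine (norm_inner_le_norm _ _).trans ?_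
          have q := A.le_opNorm x
          nlinarith [norm_nonneg x, norm_nonneg A, norm_nonneg (A x)]
        calc zeroInd (dil w τ x) * ‖inner ℝ (A x) x‖ * κ x ≤
            zeroInd (dil w τ x) * ‖A‖ * (c * η' x) := by
              gcongr
              · exact h.kappa_nonneg x
              · exact hκ x
          _ = _ := by ring
      · rw [h.kappa_zero x (le_of_not_ge hx), mul_zero, norm_zero]
        have := h'.eta_nonneg x
        positivity
    refine (abs_sub _ _).trans ?_
    rw [hD]; linarith
  obtain ⟨l, hl⟩ := exists_tendsto_deficitInt h' hw h0 hg hA hb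
  obtain ⟨m, hm⟩ := exists_tendsto_atBot_of_monotoneOn
    (f := fun τ => (∫ x, inner ℝ (A x) (dil w τ x) * κ x) + D * deficitInt η' κ' w τ)
    (b := -(‖A‖ * C * ∫ x, κ x) + D * -(energy κ' w 0 / 2))
    (monotoneOn_Iic_of_hasDerivAt (fun τ hτ => (hasDerivAt_cross_clm h hw h0 hg hA hτ).add
      ((hasDerivAt_deficitInt h' hw h0 τ).const_mul D))
      fun τ hτ => by linarith [(abs_le.1 (hbound τ hτ)).1]) fun τ hτ => by
      have q1 := deficitInt_lower_bound h' hw h0 hg hA hb hτ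
      have q2 : |∫ x, inner ℝ (A x) (dil w τ x) * κ x| ≤ ‖A‖ * C * ∫ x, κ x := by
        refine h.abs_integral_le fun x hx => (abs_real_inner_le_norm _ _).trans ?_
        have r1 : ‖A x‖ ≤ ‖A‖ := (A.le_opNorm x).trans
          (mul_le_of_le_one_right (norm_nonneg _) hx)
        have r2 : ‖dil w τ x‖ ≤ C := (norm_dil_le hw h0 _ x).trans
          (mul_le_of_le_one_right C.2 hx)
        gcongr
      have q3 := (abs_le.1 q2).1
      have q4 : 0 ≤ D := by positivity
      have q5 := mul_le_mul_of_nonneg_left q1 q4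
      linarith
  refine ⟨m - D * l, (hm.sub (hl.const_mul D)).congr fun τ => ?_⟩
  ring

/-- Convergence of the full family of dilates in the weighted `L²` sense. -/
theorem tendsto_integral_dil_sub (h : IsWeight η κ) (h' : IsWeight η' κ') (hη : ∀ x, η x ≤ η' x)
    {c : ℝ} (hκ : ∀ x, κ x ≤ c * η' x) (hc : 0 ≤ c)
    (hw : LipschitzWith C w) (h0 : w 0 = 0)
    (hg : IsGradField w fun x => 1 - zeroInd (w x)) (hA : IsGradField A fun _ => 1)
    (hb : IsBlowup w A) :
    Tendsto (fun τ => ∫ x, inner ℝ (dil w τ x - A x) (dil w τ x - A x) * κ x) atBot (𝓝 0) := by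
  obtain ⟨l₁, hl₁⟩ := exists_tendsto_energy h hw h0 hg hA hb
  obtain ⟨l₂, hl₂⟩ := exists_tendsto_cross h h' hη hκ hc hw h0 hg hA hb
  set N : ℝ → ℝ := fun τ => ∫ x, inner ℝ (dil w τ x - A x) (dil w τ x - A x) * κ x with hN
  have hN0 : ∀ τ, 0 ≤ N τ := fun τ =>
    integral_nonneg fun x => mul_nonneg real_inner_self_nonneg (h.kappa_nonneg x)
  obtain ⟨l, hl⟩ : ∃ l, Tendsto N atBot (𝓝 l) := by
    refine ⟨_, ((hl₁.sub (hl₂.const_mul 2)).add_const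
      (∫ x, inner ℝ (A x) (A x) * κ x)).congr fun τ => ?_⟩
    have cb := continuous_dil hw τ
    have i1 := h.integrable_mul_kappa (cb.inner cb (𝕜 := ℝ))
    have i2 := (h.integrable_mul_kappa (A.continuous.inner cb (𝕜 := ℝ))).const_mul 2
    have i3 := h.integrable_mul_kappa (A.continuous.inner A.continuous (𝕜 := ℝ))
    have i12 : Integrable fun x => inner ℝ (dil w τ x) (dil w τ x) * κ x -
      2 * (inner ℝ (A x) (dil w τ x) * κ x) := i1.sub i2
    rw [energy, ← integral_const_mul, ← integral_sub i1 i2, ← integral_add i12 i3]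
    simp only [hN]
    congr 1
    funext x
    rw [real_inner_sub_sub_self, real_inner_comm (A x) (dil w τ x)]; ring
  have hl0 : 0 ≤ l := ge_of_tendsto' hl hN0
  rcases hl0.eq_or_lt with rfl | hlpos
  · exact hl
  exfalso
  set k : ℝ := ∫ x, κ x with hk
  have hk0 : 0 ≤ k := integral_nonneg h.kappa_nonneg
  obtain ⟨T, hT⟩ := eventually_atBot.1 (hl.eventually (lt_mem_nhds (half_lt_self hlpos)))
  obtain ⟨τ, hτ, hcl⟩ := hb (Real.sqrt (l / (2 * (k + 1)))) (by positivity) T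
  have h1 := hT τ hτ.le
  have h2 : |N τ| ≤ (l / (2 * (k + 1))) * k := by
    refine h.abs_integral_le fun x hx => ?_
    rw [real_inner_self_eq_norm_sq, abs_of_nonneg (by positivity)]
    calc ‖dil w τ x - A x‖ ^ 2 ≤ (Real.sqrt (l / (2 * (k + 1)))) ^ 2 := by
          gcongr; exact hcl x hx
      _ = _ := Real.sq_sqrt (by positivity)
  have h3 : (l / (2 * (k + 1))) * k ≤ l / 2 := by
    rw [div_mul_eq_mul_div, div_le_div_iff₀ (by positivity) (by norm_num)]
    nlinarith
  linarith [le_abs_self (N τ)]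

end Limits

section ConcreteWeights

variable {n : ℕ} {w : En n → En n} {C : NNReal} {A : En n →L[ℝ] En n}

theorem hasDerivAt_max_zero_pow (k : ℕ) (t : ℝ) :
    HasDerivAt (fun t : ℝ => max t 0 ^ (k + 2)) (((k : ℝ) + 2) * max t 0 ^ (k + 1)) t := by
  rcases lt_trichotomy t 0 with ht | rfl | ht
  · have h1 : (fun t : ℝ => max t 0 ^ (k + 2)) =ᶠ[𝓝 t] fun _ => 0 := by
      filter_upwards [gt_mem_nhds ht] with s hs
      simp [max_eq_right hs.le]
    refine ((hasDerivAt_const t (0 : ℝ)).congr_of_eventuallyEq h1).congr_deriv ?_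
    simp [max_eq_right ht.le]
  · rw [← hasDerivWithinAt_univ, ← Set.Iic_union_Ici (a := (0 : ℝ))]
    refine HasDerivWithinAt.union ?_ ?_
    · refine ((hasDerivWithinAt_const (0 : ℝ) _ (0 : ℝ)).congr (fun s hs => ?_) ?_).congr_deriv ?_
      · simp [max_eq_right (Set.mem_Iic.1 hs)]
      · simp
      · simp
    · refine (((hasDerivAt_pow (k + 2) (0 : ℝ)).hasDerivWithinAt).congr (fun s hs => ?_)
        ?_).congr_deriv ?_
      · simp [max_eq_left (Set.mem_Ici.1 hs)]
      · simp
      · simp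
  · have h1 : (fun t : ℝ => max t 0 ^ (k + 2)) =ᶠ[𝓝 t] fun t => t ^ (k + 2) := by
      filter_upwards [lt_mem_nhds ht] with s hs
      simp [max_eq_left hs.le]
    refine ((hasDerivAt_pow (k + 2) t).congr_of_eventuallyEq h1).congr_deriv ?_
    simp [max_eq_left ht.le]

/-- The weights `(1 - |x|²)₊ ^ (k + 2)`. -/
theorem isWeight_pow (k : ℕ) : IsWeight (fun x : En n => max (1 - ‖x‖ ^ 2) 0 ^ (k + 2))
    (fun x : En n => 2 * ((k : ℝ) + 2) * max (1 - ‖x‖ ^ 2) 0 ^ (k + 1)) where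
  continuous_kappa := by fun_prop
  kappa_nonneg x := by positivity
  eta_nonneg x := by positivity
  eta_zero x hx := by
    rw [max_eq_right (by nlinarith)]; simp
  kappa_zero x hx := by
    rw [max_eq_right (by nlinarith)]; simp
  hasFDerivAt x := by
    have h1 : HasFDerivAt (fun x : En n => 1 - ‖x‖ ^ 2) (-(2 • innerSL ℝ x)) x :=
      (hasStrictFDerivAt_norm_sq x).hasFDerivAt.const_sub 1
    refine ((hasDerivAt_max_zero_pow k (1 - ‖x‖ ^ 2)).comp_hasFDerivAt x h1).congr_fderiv ?_
    ext v
    simp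
    ring

theorem tendsto_weighted_dil_sub (hw : LipschitzWith C w) (h0 : w 0 = 0)
    (hg : IsGradField w fun x => 1 - zeroInd (w x)) (hA : IsGradField A fun _ => 1)
    (hb : IsBlowup w A) :
    Tendsto (fun τ => ∫ x, ‖dil w τ x - A x‖ ^ 2 *
      (6 * max (1 - ‖x‖ ^ 2) 0 ^ 2)) atBot (𝓝 0) := by
  have key := tendsto_integral_dil_sub (c := 6) (isWeight_pow (n := n) 1) (isWeight_pow (n := n) 0)
    (fun x => ?_) (fun x => ?_) (by norm_num) hw h0 hg hA hb
  · norm_num at key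
    exact key
  · refine pow_le_pow_of_le_one (by positivity) ?_ (by norm_num)
    exact max_le (by nlinarith [norm_nonneg x]) zero_le_one
  · norm_num

theorem exists_forall_norm_dil_sub_le (hw : LipschitzWith C w) (h0 : w 0 = 0)
    (hg : IsGradField w fun x => 1 - zeroInd (w x)) (hA : IsGradField A fun _ => 1)
    (hb : IsBlowup w A) {ε : ℝ} (hε : 0 < ε) :
    ∃ T, ∀ τ ≤ T, ∀ x, ‖x‖ ≤ 1 / 2 → ‖dil w τ x - A x‖ ≤ ε := by
  set L : ℝ := C + ‖A‖ with hL
  have hL0 : 0 ≤ L := by positivity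
  set r : ℝ := min (ε / (2 * (L + 1))) (1 / 4) with hr
  have hr0 : 0 < r := lt_min (by positivity) (by norm_num)
  have hrL : L * r ≤ ε / 2 := by
    have h1 : r ≤ ε / (2 * (L + 1)) := min_le_left _ _
    rw [le_div_iff₀ (by positivity)] at h1
    nlinarith
  set V : ℝ := volume.real (ball (0 : En n) r) with hV
  have hV0 : 0 < V := ENNReal.toReal_pos (measure_ball_pos volume 0 hr0).ne'
    measure_ball_lt_top.ne
  have hpos : 0 < V * (ε / 2) ^ 2 := by positivity
  obtain ⟨T, hT⟩ := eventually_atBot.1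
    ((tendsto_weighted_dil_sub hw h0 hg hA hb).eventually (gt_mem_nhds hpos))
  refine ⟨T, fun τ hτ x hx => ?_⟩
  by_contra! hcon
  refine absurd (hT τ hτ) (not_lt.2 ?_)
  have hVx : volume.real (ball x r) = V := by
    rw [hV, measureReal_def, measureReal_def, Measure.addHaar_ball_center volume x r]
  have hc : Continuous fun x => inner ℝ (dil w τ x - A x) (dil w τ x - A x) :=
    ((continuous_dil hw τ).sub A.continuous).inner ((continuous_dil hw τ).sub A.continuous)
  have h_integ := (isWeight_pow (n := n) 1).integrable_mul_kappa hc
  norm_num at h_integ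
  have hi : Integrable ((ball x r).indicator fun _ => (ε / 2) ^ 2) :=
    (integrable_indicator_iff measurableSet_ball).2 (integrableOn_const measure_ball_lt_top.ne)
  calc V * (ε / 2) ^ 2 = ∫ y, (ball x r).indicator (fun _ => (ε / 2) ^ 2) y := by
        rw [integral_indicator_const _ measurableSet_ball, hVx, smul_eq_mul]
    _ ≤ _ := integral_mono hi h_integ fun y => ?_
  by_cases hy : y ∈ ball x r
  · rw [Set.indicator_of_mem hy]
    rw [mem_ball, dist_eq_norm] at hy
    have hr4 : r ≤ 1 / 4 := min_le_right _ _
    have hy1 : ‖y‖ ≤ 3 / 4 := by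
      have := norm_add_le (y - x) x
      rw [sub_add_cancel] at this
      linarith
    have hk : 1 ≤ 6 * max (1 - ‖y‖ ^ 2) 0 ^ 2 := by
      have : 7 / 16 ≤ max (1 - ‖y‖ ^ 2) 0 := le_max_of_le_left (by nlinarith [norm_nonneg y])
      nlinarith
    have hv : ε / 2 ≤ ‖dil w τ y - A y‖ := by
      have h1 := (dil_lipschitzWith hw τ).dist_le_mul y x
      rw [dist_eq_norm, dist_eq_norm] at h1
      have h2 := A.le_opNorm (y - x)
      have h3 : dil w τ x - A x = (dil w τ y - A y) - (dil w τ y - dil w τ x) + A (y - x) := by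
        rw [map_sub]; abel
      have h4 : ‖dil w τ x - A x‖ ≤
          ‖dil w τ y - A y‖ + ‖dil w τ y - dil w τ x‖ + ‖A (y - x)‖ := by
        rw [h3]
        exact (norm_add_le _ _).trans (by gcongr; exact norm_sub_le _ _)
      have h5 : L * ‖y - x‖ ≤ L * r := by gcongr
      have h6 : L * ‖y - x‖ = C * ‖y - x‖ + ‖A‖ * ‖y - x‖ := by rw [hL]; ring
      linarith
    have h7 : (ε / 2) ^ 2 ≤ ‖dil w τ y - A y‖ ^ 2 := by gcongr
    nlinarith [sq_nonneg ‖dil w τ y - A y‖]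
  · rw [Set.indicator_of_notMem hy]
    positivity

/-- A blow-up limit along a sequence of scales is the Fréchet derivative at the origin. -/
theorem IsBlowup.norm_sub_le (hb : IsBlowup w A) (hw : LipschitzWith C w) (h0 : w 0 = 0)
    (hg : IsGradField w fun x => 1 - zeroInd (w x)) (hA : IsGradField A fun _ => 1)
    {ε : ℝ} (hε : 0 < ε) : ∃ ρ > 0, ∀ y, ‖y‖ ≤ ρ → ‖w y - A y‖ ≤ ε * ‖y‖ := by
  obtain ⟨T, hT⟩ := exists_forall_norm_dil_sub_le hw h0 hg hA hb (half_pos hε)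
  refine ⟨Real.exp T / 2, by positivity, fun y hy => ?_⟩
  by_cases hy0 : y = 0
  · simp [hy0, h0]
  have hyn : 0 < ‖y‖ := norm_pos_iff.2 hy0
  set τ : ℝ := Real.log (2 * ‖y‖) with hτ
  have he : Real.exp τ = 2 * ‖y‖ := Real.exp_log (by positivity)
  have hτT : τ ≤ T := by
    rw [← Real.exp_le_exp, he]; linarith
  have e1 : Real.exp τ * Real.exp (-τ) = 1 := by rw [← Real.exp_add]; simp
  have hx : ‖Real.exp (-τ) • y‖ ≤ 1 / 2 := by
    rw [norm_smul, Real.norm_of_nonneg (Real.exp_pos _).le]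
    rw [he] at e1
    linarith
  have h1 := hT τ hτT _ hx
  have h2 : w y - A y = Real.exp τ • (dil w τ (Real.exp (-τ) • y) - A (Real.exp (-τ) • y)) := by
    rw [dil, smul_smul, e1, one_smul, smul_sub, smul_smul, e1, one_smul, map_smul, smul_smul, e1,
      one_smul]
  rw [h2, norm_smul, Real.norm_of_nonneg (Real.exp_pos _).le, he]
  nlinarith

end ConcreteWeights

section QuadraticForms

variable {n : ℕ} {M : Matrix (Fin n) (Fin n) ℝ}

/-- The linear map `x ↦ M x` on Euclidean space. -/
def matCLM (M : Matrix (Fin n) (Fin n) ℝ) : En n →L[ℝ] En n :=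
  Matrix.toEuclideanCLM (n := Fin n) (𝕜 := ℝ) M

theorem matCLM_apply (M : Matrix (Fin n) (Fin n) ℝ) (x : En n) (i : Fin n) :
    matCLM M x i = ∑ j, M i j * x j := by
  have := congrFun (Matrix.ofLp_toEuclideanCLM M x) i
  rw [Matrix.mulVec, dotProduct] at this
  exact this

theorem inner_matCLM (M : Matrix (Fin n) (Fin n) ℝ) (x y : En n) :
    inner ℝ (matCLM M x) y = ∑ i, ∑ j, M i j * y i * x j := by
  rw [PiLp.inner_apply]
  refine Finset.sum_congr rfl fun i _ => ?_
  rw [matCLM_apply]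
  simp only [RCLike.inner_apply, conj_trivial]
  rw [Finset.mul_sum]
  exact Finset.sum_congr rfl fun j _ => by ring

theorem inner_matCLM_comm (hM : M.IsSymm) (x y : En n) :
    inner ℝ (matCLM M x) y = inner ℝ (matCLM M y) x := by
  rw [inner_matCLM, inner_matCLM, Finset.sum_comm]
  refine Finset.sum_congr rfl fun i _ => Finset.sum_congr rfl fun j _ => ?_
  rw [hM.apply]
  ring

theorem trace_matCLM (M : Matrix (Fin n) (Fin n) ℝ) :
    LinearMap.trace ℝ (En n) (matCLM M : En n →ₗ[ℝ] En n) = M.trace := by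
  rw [trace_eq_sum_single, Matrix.trace]
  refine Finset.sum_congr rfl fun i _ => ?_
  rw [matCLM_apply]
  simp

theorem quadForm_eq (M : Matrix (Fin n) (Fin n) ℝ) (x : En n) :
    (1 / 2) * ∑ i, ∑ j, M i j * x i * x j = (1 / 2) * inner ℝ (matCLM M x) x := by
  rw [inner_matCLM]

theorem hasGradientAt_quadForm (hM : M.IsSymm) (x : En n) :
    HasGradientAt (fun y : En n => (1 / 2) * ∑ i, ∑ j, M i j * y i * y j) (matCLM M x) x := by
  simp only [quadForm_eq]
  rw [hasGradientAt_iff_hasFDerivAt]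
  refine ((((matCLM M).hasFDerivAt (x := x)).inner ℝ (hasFDerivAt_id x)).const_mul
    (1 / 2)).congr_fderiv ?_
  ext v
  have := inner_matCLM_comm hM v x
  simp
  rw [this]
  ring

theorem matCLM_injective : Function.Injective (matCLM (n := n)) :=
  (Matrix.toEuclideanCLM (n := Fin n) (𝕜 := ℝ)).injective

end QuadraticForms

section Rescalings

variable {n : ℕ} {u : En n → ℝ}

theorem hasGradientAt_rescale {r : ℝ} (hr : 0 < r) (c : ℝ) {x : En n}
    (hu : DifferentiableAt ℝ u (r • x)) :
    HasGradientAt (fun y => (u (r • y) - c) / r ^ 2) (r⁻¹ • gradient u (r • x)) x := by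
  rw [hasGradientAt_iff_hasFDerivAt]
  have h1 : HasFDerivAt (fun y : En n => r • y) (r • ContinuousLinearMap.id ℝ (En n)) x :=
    (r • ContinuousLinearMap.id ℝ (En n)).hasFDerivAt
  have h2 := ((hu.hasGradientAt.hasFDerivAt.comp x h1).sub_const c).mul_const (r ^ 2)⁻¹
  simp only [div_eq_mul_inv]
  refine h2.congr_fderiv ?_
  ext v
  simp
  field_simp

theorem gradient_symmetric_fderiv {D : En n →L[ℝ] En n} {x : En n}
    (hu : ∀ᶠ y in 𝓝 x, DifferentiableAt ℝ u y) (hD : HasFDerivAt (fun y => gradient u y) D x)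
    (v w : En n) : inner ℝ (D v) w = inner ℝ (D w) v := by
  have h1 : ∀ᶠ y in 𝓝 x, HasFDerivAt u (innerSL ℝ (gradient u y)) y := by
    filter_upwards [hu] with y hy using hy.hasGradientAt.hasFDerivAt
  have h2 : HasFDerivAt (fun y => innerSL ℝ (gradient u y)) ((innerSL ℝ).comp D) x :=
    ((innerSL ℝ : En n →L[ℝ] _).hasFDerivAt).comp x hD
  simpa using second_derivative_symmetric_of_eventually h1 h2 v w

theorem SolutionHyp.exists_gradField (hu : SolutionHyp u) :
    ∃ (C : NNReal) (w : En n → En n), LipschitzWith C w ∧ w 0 = 0 ∧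
      (∀ x ∈ ball (0 : En n) 1, gradient u x = w x) ∧
      IsGradField w fun x => 1 - zeroInd (w x) := by
  obtain ⟨hd, ⟨L, hL⟩, hae, -, h0⟩ := hu
  obtain ⟨w, hw, heq⟩ := hL.extend_finite_dimension
  have hw0 : w 0 = 0 := by rw [← heq (mem_ball_self one_pos)]; exact h0
  refine ⟨_, w, hw, hw0, heq, ⟨_, hw⟩, ?_⟩
  rw [ae_restrict_iff' measurableSet_ball] at hae
  filter_upwards [hae] with x hx hx1
  obtain ⟨D, hD, ht0, ht1⟩ := hx hx1
  have hnhds := isOpen_ball.mem_nhds hx1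
  have hDw : HasFDerivAt w D x := hD.congr_of_eventuallyEq
    (by filter_upwards [hnhds] with y hy using (heq hy).symm)
  rw [hDw.fderiv]
  refine ⟨hDw.differentiableAt, gradient_symmetric_fderiv
    (by filter_upwards [hnhds] with y hy using hd y hy) hD, ?_⟩
  have hx2 : gradient u x = w x := heq hx1
  by_cases hz : w x = 0
  · rw [ht0 (hx2.trans hz), hz, zeroInd_zero, sub_self]
  · rw [ht1 (by rwa [hx2]), zeroInd_of_ne hz, sub_zero]

theorem qB_eq_quadForm (B : Matrix (Fin n) (Fin n) ℝ) (hn : n ≠ 0) :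
    qB B = fun x : En n =>
      (1 / 2) * ∑ i, ∑ j, ((n : ℝ)⁻¹ • (1 : Matrix (Fin n) (Fin n) ℝ) + B) i j * x i * x j := by
  funext x
  have hn' : (n : ℝ) ≠ 0 := Nat.cast_ne_zero.2 hn
  have h1 : ∑ i, ∑ j, ((n : ℝ)⁻¹ • (1 : Matrix (Fin n) (Fin n) ℝ)) i j * x i * x j =
      (n : ℝ)⁻¹ * ‖x‖ ^ 2 := by
    rw [EuclideanSpace.real_norm_sq_eq, Finset.mul_sum]
    refine Finset.sum_congr rfl fun i _ => ?_
    rw [Finset.sum_eq_single i]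
    · simp; ring
    · intro j _ hj; simp [Matrix.one_apply_ne' hj]
    · simp
  simp only [Matrix.add_apply, add_mul, Finset.sum_add_distrib]
  rw [h1, qB, p0, psiM]
  field_simp

theorem isBlowup_of_tendsto {w : En n → En n} (hd : ∀ x ∈ ball (0 : En n) 1, DifferentiableAt ℝ u x)
    (hw : ∀ x ∈ ball (0 : En n) 1, gradient u x = w x) {q : En n → ℝ} {A : En n →L[ℝ] En n}
    (hq : ∀ x, gradient q x = A x) {r : ℕ → ℝ} (hr : ∀ k, 0 < r k) (hr0 : Tendsto r atTop (𝓝 0))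
    (hlim : TendstoUniformlyOn (fun k x => gradient (fun y => (u (r k • y) - u 0) / (r k) ^ 2) x)
        (fun x => gradient q x) atTop (closedBall 0 1)) : IsBlowup w A := by
  intro ε hε T
  obtain ⟨k, hk1, hk2⟩ := ((Metric.tendstoUniformlyOn_iff.1 hlim ε hε).and
    (hr0.eventually (gt_mem_nhds (lt_min one_pos (Real.exp_pos T))))).exists
  refine ⟨Real.log (r k), ?_, fun x hx => ?_⟩
  · rw [← Real.exp_lt_exp, Real.exp_log (hr k)]
    exact hk2.trans_le (min_le_right _ _)
  · have hmem : r k • x ∈ ball (0 : En n) 1 := by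
      rw [mem_ball_zero_iff, norm_smul, Real.norm_of_nonneg (hr k).le]
      have := hk2.trans_le (min_le_left _ _)
      nlinarith [hr k]
    have h1 := (hk1 x (by simpa using hx)).le
    rw [(hasGradientAt_rescale (hr k) (u 0) (hd _ hmem)).gradient, hq, hw _ hmem, dist_eq_norm,
      norm_sub_rev] at h1
    rw [dil, Real.exp_neg, Real.exp_log (hr k)]
    exact h1

theorem tendstoUniformlyOn_rescale_gradient {w : En n → En n} {A : En n →L[ℝ] En n}
    (hd : ∀ x ∈ ball (0 : En n) 1, DifferentiableAt ℝ u x)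
    (hw : ∀ x ∈ ball (0 : En n) 1, gradient u x = w x)
    (hA : ∀ ε > 0, ∃ ρ > 0, ∀ y, ‖y‖ ≤ ρ → ‖w y - A y‖ ≤ ε * ‖y‖)
    {q : En n → ℝ} (hq : ∀ x, gradient q x = A x) {K : Set (En n)} (hK : IsCompact K) :
    TendstoUniformlyOn (fun (r : ℝ) (x : En n) => gradient (fun y => (u (r • y) - u 0) / r ^ 2) x)
      (fun x => gradient q x) (𝓝[>] 0) K := by
  obtain ⟨R, hR, hKR⟩ := hK.isBounded.subset_closedBall_lt 0 0
  rw [Metric.tendstoUniformlyOn_iff]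
  intro ε hε
  obtain ⟨ρ, hρ, hest⟩ := hA (ε / (R + 1)) (by positivity)
  filter_upwards [Ioo_mem_nhdsGT (show 0 < min ρ 1 / (R + 1) by positivity)] with r hr x hx
  have hxR : ‖x‖ ≤ R := by simpa using hKR hx
  have hr0 : 0 < r := hr.1
  have hrx : ‖r • x‖ < min ρ 1 := by
    have := hr.2
    rw [lt_div_iff₀ (by positivity)] at this
    rw [norm_smul, Real.norm_of_nonneg hr0.le]
    nlinarith
  have hmem : r • x ∈ ball (0 : En n) 1 := by
    rw [mem_ball_zero_iff]; exact hrx.trans_le (min_le_right _ _)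
  have h1 := hest (r • x) (hrx.le.trans (min_le_left _ _))
  rw [(hasGradientAt_rescale hr0 (u 0) (hd _ hmem)).gradient, hq, hw _ hmem, dist_eq_norm,
    norm_sub_rev]
  have h2 : r⁻¹ • w (r • x) - A x = r⁻¹ • (w (r • x) - A (r • x)) := by
    rw [smul_sub, map_smul, smul_smul, inv_mul_cancel₀ hr0.ne', one_smul]
  rw [h2, norm_smul, norm_inv, Real.norm_of_nonneg hr0.le]
  rw [norm_smul, Real.norm_of_nonneg hr0.le] at h1
  calc r⁻¹ * ‖w (r • x) - A (r • x)‖ ≤ r⁻¹ * (ε / (R + 1) * (r * ‖x‖)) := by gcongr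
    _ = ε / (R + 1) * ‖x‖ := by field_simp
    _ ≤ ε / (R + 1) * R := by gcongr
    _ < ε := by
      rw [div_mul_eq_mul_div, div_lt_iff₀ (by positivity)]
      nlinarith

theorem tendstoUniformlyOn_rescale {w : En n → En n} {A : En n →L[ℝ] En n}
    (hd : ∀ x ∈ ball (0 : En n) 1, DifferentiableAt ℝ u x)
    (hw : ∀ x ∈ ball (0 : En n) 1, gradient u x = w x)
    (hA : ∀ ε > 0, ∃ ρ > 0, ∀ y, ‖y‖ ≤ ρ → ‖w y - A y‖ ≤ ε * ‖y‖)
    {q : En n → ℝ} (hq : ∀ x, HasGradientAt q (A x) x) (hq2 : ∀ (r : ℝ) x, q (r • x) = r ^ 2 * q x)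
    {K : Set (En n)} (hK : IsCompact K) :
    TendstoUniformlyOn (fun (r : ℝ) (x : En n) => (u (r • x) - u 0) / r ^ 2) q (𝓝[>] 0) K := by
  obtain ⟨R, hR, hKR⟩ := hK.isBounded.subset_closedBall_lt 0 0
  rw [Metric.tendstoUniformlyOn_iff]
  intro ε hε
  obtain ⟨ρ, hρ, hest⟩ := hA (ε / (R ^ 2 + 1)) (by positivity)
  filter_upwards [Ioo_mem_nhdsGT (show 0 < min ρ 1 / (R + 1) by positivity)] with r hr x hx
  have hxR : ‖x‖ ≤ R := by simpa using hKR hx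
  have hr0 : 0 < r := hr.1
  have hrx : ‖r • x‖ < min ρ 1 := by
    have := hr.2
    rw [lt_div_iff₀ (by positivity)] at this
    rw [norm_smul, Real.norm_of_nonneg hr0.le]
    nlinarith
  set s : ℝ := ‖r • x‖ with hs
  have hmv : ‖(u (r • x) - q (r • x)) - (u 0 - q 0)‖ ≤
      ε / (R ^ 2 + 1) * s * ‖r • x - 0‖ := by
    refine (convex_closedBall (0 : En n) s).norm_image_sub_le_of_norm_hasFDerivWithin_le
      (f := fun y => u y - q y) (f' := fun y => InnerProductSpace.toDual ℝ (En n) (w y - A y))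
      (fun y hy => ?_) (fun y hy => ?_) (mem_closedBall_self (norm_nonneg _)) (by simp [hs])
    · have hy1 : y ∈ ball (0 : En n) 1 := by
        simp only [mem_closedBall_zero_iff] at hy
        rw [mem_ball_zero_iff]; exact (hy.trans_lt hrx).trans_le (min_le_right _ _)
      have h1 := (hd y hy1).hasGradientAt.hasFDerivAt
      rw [hw y hy1] at h1
      refine (h1.sub (hq y).hasFDerivAt).hasFDerivWithinAt.congr_fderiv ?_
      rw [map_sub]
    · simp only [mem_closedBall_zero_iff] at hy
      rw [LinearIsometryEquiv.norm_map]
      refine (hest y (hy.trans (hrx.le.trans (min_le_left _ _)))).trans ?_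
      gcongr
  have hq0 : q 0 = 0 := by simpa using hq2 0 0
  rw [sub_zero, ← hs, hq2, hq0, sub_zero] at hmv
  have e : (u (r • x) - u 0) / r ^ 2 - q x = (u (r • x) - r ^ 2 * q x - u 0) / r ^ 2 := by
    field_simp
    ring
  rw [dist_comm, dist_eq_norm, e, norm_div, norm_pow, Real.norm_of_nonneg hr0.le,
    div_lt_iff₀ (by positivity)]
  refine hmv.trans_lt ?_
  rw [hs, norm_smul, Real.norm_of_nonneg hr0.le]
  calc ε / (R ^ 2 + 1) * (r * ‖x‖) * (r * ‖x‖) = ε / (R ^ 2 + 1) * ‖x‖ ^ 2 * r ^ 2 := by ring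
    _ ≤ ε / (R ^ 2 + 1) * R ^ 2 * r ^ 2 := by gcongr
    _ < ε * r ^ 2 := by
      gcongr
      rw [div_mul_eq_mul_div, div_lt_iff₀ (by positivity)]
      nlinarith

end Rescalings

/-- uniqueness of the quadratic blow-up at a singular point. -/
theorem stmt_0 (n : ℕ) (hn : 2 ≤ n) (u : En n → ℝ)
    (hu : SolutionHyp u) (hsing : IsSingular u) :
    ∃! A₀ : Matrix (Fin n) (Fin n) ℝ,
      A₀.IsSymm ∧ A₀.trace = 1 ∧
      (∀ K : Set (En n), IsCompact K →
        TendstoUniformlyOn (fun (r : ℝ) (x : En n) => (u (r • x) - u 0) / r^2)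
          (fun x => (1/2) * ∑ i, ∑ j, A₀ i j * x i * x j)
          (nhdsWithin (0:ℝ) (Set.Ioi 0)) K ∧
        TendstoUniformlyOn
          (fun (r : ℝ) (x : En n) => gradient (fun y => (u (r • y) - u 0) / r^2) x)
          (fun x => gradient (fun y => (1/2) * ∑ i, ∑ j, A₀ i j * y i * y j) x)
          (nhdsWithin (0:ℝ) (Set.Ioi 0)) K) := by
  obtain ⟨C, w, hwL, hw0, hw, hg⟩ := hu.exists_gradField
  have hd := hu.1
  obtain ⟨r, B, hr, hr0, ⟨hBs, hBt⟩, hlim⟩ := hsing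
  have hn0 : n ≠ 0 := by omega
  set A₀ : Matrix (Fin n) (Fin n) ℝ := (n : ℝ)⁻¹ • (1 : Matrix (Fin n) (Fin n) ℝ) + B with hA₀
  have hs : A₀.IsSymm := (Matrix.isSymm_one.smul _).add hBs
  have ht : A₀.trace = 1 := by
    rw [hA₀, Matrix.trace_add, Matrix.trace_smul, hBt, Matrix.trace_one]
    simp [hn0]
  have hA : IsGradField (matCLM A₀) fun _ => 1 :=
    isGradField_clm (inner_matCLM_comm hs) (by rw [trace_matCLM, ht])
  have hgrad : ∀ x, HasGradientAt (fun y : En n => (1/2) * ∑ i, ∑ j, A₀ i j * y i * y j)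
      (matCLM A₀ x) x := hasGradientAt_quadForm hs
  have hb : IsBlowup w (matCLM A₀) := by
    have h1 := (hlim (closedBall 0 1) (isCompact_closedBall _ _)).2
    rw [qB_eq_quadForm B hn0] at h1
    exact isBlowup_of_tendsto hd hw (fun x => (hgrad x).gradient) hr hr0 h1
  have hest : ∀ ε > 0, ∃ ρ > 0, ∀ y, ‖y‖ ≤ ρ → ‖w y - matCLM A₀ y‖ ≤ ε * ‖y‖ :=
    fun ε hε => hb.norm_sub_le hwL hw0 hg hA hε
  have hconv : ∀ K : Set (En n), IsCompact K →
      TendstoUniformlyOn (fun (r : ℝ) (x : En n) => (u (r • x) - u 0) / r^2)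
        (fun x => (1/2) * ∑ i, ∑ j, A₀ i j * x i * x j) (𝓝[>] 0) K := fun K hK =>
    tendstoUniformlyOn_rescale hd hw hest hgrad (fun r x => by
      simp only [quadForm_eq, map_smul, real_inner_smul_left, real_inner_smul_right]; ring) hK
  refine ⟨A₀, ⟨hs, ht, fun K hK => ⟨hconv K hK,
    tendstoUniformlyOn_rescale_gradient hd hw hest (fun x => (hgrad x).gradient) hK⟩⟩, ?_⟩
  rintro A₁ ⟨hs₁, -, hA₁⟩
  have heq : (fun x : En n => (1/2) * ∑ i, ∑ j, A₁ i j * x i * x j) =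
      fun x : En n => (1/2) * ∑ i, ∑ j, A₀ i j * x i * x j := by
    funext x
    exact tendsto_nhds_unique ((hA₁ {x} isCompact_singleton).1.tendsto_at rfl)
      ((hconv {x} isCompact_singleton).tendsto_at rfl)
  refine matCLM_injective (ContinuousLinearMap.ext fun x => ?_)
  have h1 := hasGradientAt_quadForm hs₁ x
  rw [heq] at h1
  exact h1.unique (hgrad x)

end
end

section
/- For every R < ∞ there exist T_R < ∞ and M_R < ∞ such that for all t ≥ T_R and all x, y in the closed ball of radius R centered at the origin: |u_t(x)| ≤ (M_R/2)|x|², |∇u_t(x)| ≤ M_R |x|, and |∇u_t(x) − ∇u_t(y)| ≤ M_R |x − y|. Moreover, for every sequence t_j → ∞ there is a subsequence t_{j_m} and a C¹ function v on the closed ball of radius R such that u_{t_{j_m}} → v and ∇u_{t_{j_m}} → ∇v uniformly on that ball. -/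
open MeasureTheory Metric Filter Topology Pointwise

noncomputable section

/-- Sequential Arzelà–Ascoli for maps that are uniformly Lipschitz on a compact set. -/
theorem exists_subseq_tendstoUniformlyOn {α β : Type*} [PseudoMetricSpace α] [MetricSpace β]
    [Nonempty β] {K : Set α} (hK : IsCompact K) {S : Set β} (hS : IsCompact S) (C : NNReal)
    (F : ℕ → α → β) (hF : ∀ j, LipschitzOnWith C (F j) K) (hFS : ∀ j, Set.MapsTo (F j) K S) :
    ∃ φ : ℕ → ℕ, StrictMono φ ∧ ∃ f : α → β, ContinuousOn f K ∧
      TendstoUniformlyOn (fun m => F (φ m)) f atTop K := by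
  classical
  have : CompactSpace K := isCompact_iff_compactSpace.mp hK
  let G : ℕ → BoundedContinuousFunction K β := fun j =>
    BoundedContinuousFunction.mkOfCompact ⟨K.domRestrict (F j), (hF j).continuousOn.domRestrict⟩
  have hcomp : IsCompact (closure (Set.range G)) := by
    refine BoundedContinuousFunction.arzela_ascoli S hS _ ?_ ?_
    · rintro _ x ⟨j, rfl⟩
      exact hFS j x.2
    · refine (LipschitzWith.uniformEquicontinuous _ C ?_).equicontinuous
      rintro ⟨_, j, rfl⟩
      exact (hF j).to_restrict
  obtain ⟨f, -, φ, hφ, hlim⟩ := hcomp.tendsto_subseq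
    (fun j => subset_closure (Set.mem_range_self j) : ∀ j, G j ∈ closure (Set.range G))
  let f' : α → β := fun x => if h : x ∈ K then f ⟨x, h⟩ else Classical.arbitrary β
  have hf' : f' ∘ ((↑) : K → α) = f := by
    funext x
    simp [f']
  refine ⟨φ, hφ, f', ?_, ?_⟩
  · rw [continuousOn_iff_continuous_domRestrict]
    exact (congrArg Continuous hf').mpr f.continuous
  · rw [tendstoUniformlyOn_iff_tendstoUniformly_comp_coe, hf']
    exact BoundedContinuousFunction.tendsto_iff_tendstoUniformly.mp hlim

theorem hasGradientAt_ut {n : ℕ} {u : En n → ℝ} {t : ℝ} {x : En n}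
    (h : DifferentiableAt ℝ u (Real.exp (-t) • x)) :
    HasGradientAt (ut u t) (Real.exp t • gradient u (Real.exp (-t) • x)) x := by
  have h1 := h.hasGradientAt.hasFDerivAt
  have h2 : HasFDerivAt (fun y : En n => Real.exp (-t) • y)
      (Real.exp (-t) • ContinuousLinearMap.id ℝ (En n)) x :=
    (hasFDerivAt_id x).fun_const_smul _
  have h3 := ((h1.comp x h2).sub_const (u 0)).const_mul (Real.exp (2 * t))
  rw [hasGradientAt_iff_hasFDerivAt]
  refine h3.congr_fderiv ?_
  ext y
  have : Real.exp (2 * t) * Real.exp (-t) = Real.exp t := by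
    rw [← Real.exp_add]; ring_nf
  simp [← mul_assoc, this]

theorem lipschitzOnWith_gradient_ut {n : ℕ} {u : En n → ℝ} {L : NNReal} {t R : ℝ}
    (hd : ∀ x ∈ ball (0 : En n) 1, DifferentiableAt ℝ u x)
    (hL : LipschitzOnWith L (fun x => gradient u x) (ball (0 : En n) 1))
    (hmem : ∀ x ∈ closedBall (0 : En n) R, Real.exp (-t) • x ∈ ball (0 : En n) 1) :
    LipschitzOnWith L (fun x => gradient (ut u t) x) (closedBall (0 : En n) R) := by
  refine LipschitzOnWith.of_dist_le_mul fun x hx y hy => ?_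
  simp only [(hasGradientAt_ut (hd _ (hmem x hx))).gradient,
    (hasGradientAt_ut (hd _ (hmem y hy))).gradient]
  have h := hL.dist_le_mul _ (hmem x hx) _ (hmem y hy)
  rw [dist_smul₀, Real.norm_of_nonneg (Real.exp_pos _).le] at h ⊢
  calc Real.exp t * dist (gradient u (Real.exp (-t) • x)) (gradient u (Real.exp (-t) • y))
      ≤ Real.exp t * (L * (Real.exp (-t) * dist x y)) := by gcongr
    _ = (Real.exp t * Real.exp (-t)) * (L * dist x y) := by ring
    _ = L * dist x y := by rw [← Real.exp_add, add_neg_cancel, Real.exp_zero, one_mul]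

theorem exp_neg_smul_mem_ball {n : ℕ} {t R : ℝ} (ht : |R| ≤ t) {x : En n}
    (hx : x ∈ closedBall (0 : En n) R) : Real.exp (-t) • x ∈ ball (0 : En n) 1 := by
  rw [mem_closedBall_zero_iff] at hx
  rw [mem_ball_zero_iff, norm_smul, Real.norm_of_nonneg (Real.exp_pos _).le]
  have h : ‖x‖ < Real.exp t := by
    linarith [Real.add_one_le_exp t, le_abs_self R]
  calc Real.exp (-t) * ‖x‖ < Real.exp (-t) * Real.exp t := by gcongr
    _ = 1 := by rw [← Real.exp_add, neg_add_cancel, Real.exp_zero]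

section Rescaling

variable {n : ℕ} {u : En n → ℝ} {L : NNReal} {t R : ℝ}

theorem gradient_ut_zero (hd : DifferentiableAt ℝ u 0) (h0 : gradient u 0 = 0) :
    gradient (ut u t) 0 = 0 := by
  rw [(hasGradientAt_ut (by simpa using hd)).gradient, smul_zero, h0, smul_zero]

theorem norm_gradient_ut_le (hd : ∀ x ∈ ball (0 : En n) 1, DifferentiableAt ℝ u x)
    (hL : LipschitzOnWith L (fun x => gradient u x) (ball (0 : En n) 1))
    (h0 : gradient u 0 = 0) (ht : |R| ≤ t) {x : En n} (hx : x ∈ closedBall (0 : En n) R) :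
    ‖gradient (ut u t) x‖ ≤ L * ‖x‖ := by
  have hz : (0 : En n) ∈ closedBall (0 : En n) R :=
    mem_closedBall_self (nonempty_closedBall.mp ⟨x, hx⟩)
  have h := (lipschitzOnWith_gradient_ut hd hL
    fun x hx => exp_neg_smul_mem_ball ht hx).dist_le_mul x hx 0 hz
  rwa [gradient_ut_zero (hd 0 (mem_ball_self one_pos)) h0, dist_zero_right,
    dist_zero_right] at h

theorem abs_ut_sub_le (hd : ∀ x ∈ ball (0 : En n) 1, DifferentiableAt ℝ u x)
    (hL : LipschitzOnWith L (fun x => gradient u x) (ball (0 : En n) 1))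
    (h0 : gradient u 0 = 0) {r : ℝ} (hr : r ≤ R) (ht : |R| ≤ t) {x y : En n}
    (hx : x ∈ closedBall (0 : En n) r) (hy : y ∈ closedBall (0 : En n) r) :
    |ut u t x - ut u t y| ≤ L * r * ‖x - y‖ := by
  refine (convex_closedBall (0 : En n) r).norm_image_sub_le_of_norm_hasFDerivWithin_le
    (f' := fun z => InnerProductSpace.toDual ℝ (En n) (gradient (ut u t) z))
    (fun z hz => ?_) (fun z hz => ?_) hy hx
  · have hz' := exp_neg_smul_mem_ball ht (closedBall_subset_closedBall hr hz)
    exact (hasGradientAt_ut (hd _ hz')).differentiableAt.hasGradientAt.hasFDerivAt.hasFDerivWithinAt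
  · rw [LinearIsometryEquiv.norm_map]
    refine (norm_gradient_ut_le hd hL h0 ht (closedBall_subset_closedBall hr hz)).trans ?_
    gcongr
    simpa using hz

end Rescaling

/-- uniform C^{1,1} bounds on the rescalings and compactness. -/
theorem stmt_1 (n : ℕ) (hn : 2 ≤ n) (u : En n → ℝ) (hu : SolutionHyp u) (R : ℝ) :
    (∃ T M : ℝ, ∀ t, T ≤ t → ∀ x ∈ closedBall (0:En n) R, ∀ y ∈ closedBall (0:En n) R,
        |ut u t x| ≤ M/2 * ‖x‖^2 ∧
        ‖gradient (ut u t) x‖ ≤ M * ‖x‖ ∧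
        ‖gradient (ut u t) x - gradient (ut u t) y‖ ≤ M * ‖x - y‖) ∧
    (∀ t : ℕ → ℝ, Tendsto t atTop atTop →
      ∃ φ : ℕ → ℕ, StrictMono φ ∧
        ∃ v : En n → ℝ, ∃ g : En n → En n,
          ContinuousOn v (closedBall (0:En n) R) ∧
          ContinuousOn g (closedBall (0:En n) R) ∧
          (∀ x ∈ ball (0:En n) R, HasGradientAt v (g x) x) ∧
          TendstoUniformlyOn (fun m x => ut u (t (φ m)) x) v atTop
            (closedBall (0:En n) R) ∧
          TendstoUniformlyOn (fun m x => gradient (ut u (t (φ m))) x) g atTop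
            (closedBall (0:En n) R)) := by
  obtain ⟨hd, ⟨L, hL⟩, -, -, h0⟩ := hu
  refine ⟨⟨|R|, 2 * L, fun t ht x hx y hy => ⟨?_, ?_, ?_⟩⟩, fun t ht => ?_⟩
  · have h := abs_ut_sub_le hd hL h0 (by simpa using hx) ht (x := x) (y := 0) (r := ‖x‖)
      (by simp) (by simp)
    have hz : ut u t 0 = 0 := by simp [ut]
    rw [hz, sub_zero, sub_zero] at h
    linarith
  · refine (norm_gradient_ut_le hd hL h0 ht hx).trans ?_
    gcongr
    linarith [L.2]
  · rw [← dist_eq_norm, ← dist_eq_norm]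
    refine ((lipschitzOnWith_gradient_ut hd hL
      fun x hx => exp_neg_smul_mem_ball ht hx).dist_le_mul x hx y hy).trans ?_
    gcongr
    linarith [L.2]
  · obtain ⟨N, hN⟩ := eventually_atTop.mp (ht.eventually_ge_atTop |R|)
    have hN' : ∀ j, |R| ≤ t (j + N) := fun j => hN _ (Nat.le_add_left N j)
    let F : ℕ → En n → ℝ × En n := fun j x => (ut u (t (j + N)) x, gradient (ut u (t (j + N))) x)
    have hval : ∀ j, LipschitzOnWith (L * R.toNNReal) (fun x => ut u (t (j + N)) x)
        (closedBall (0 : En n) R) := by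
      refine fun j => LipschitzOnWith.of_dist_le_mul fun x hx y hy => ?_
      have hR : 0 ≤ R := nonempty_closedBall.mp ⟨x, hx⟩
      have h := abs_ut_sub_le hd hL h0 le_rfl (hN' j) hx hy
      rwa [NNReal.coe_mul, Real.coe_toNNReal _ hR, Real.dist_eq, dist_eq_norm]
    have hgrad : ∀ j, LipschitzOnWith L (fun x => gradient (ut u (t (j + N))) x)
        (closedBall (0 : En n) R) := fun j =>
      lipschitzOnWith_gradient_ut hd hL fun x hx => exp_neg_smul_mem_ball (hN' j) hx
    obtain ⟨φ, hφ, f, hf, hlim⟩ := exists_subseq_tendstoUniformlyOn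
      (isCompact_closedBall (0 : En n) R)
      ((isCompact_closedBall (0 : ℝ) (L * R * R)).prod (isCompact_closedBall (0 : En n) (L * R)))
      (max (L * R.toNNReal) L) F (fun j => (hval j).prodMk (hgrad j)) (by
        intro j x hx
        have hR : 0 ≤ R := nonempty_closedBall.mp ⟨x, hx⟩
        have hx' : ‖x‖ ≤ R := by simpa using hx
        have hz : ut u (t (j + N)) 0 = 0 := by simp [ut]
        refine ⟨?_, ?_⟩
        · have h := abs_ut_sub_le hd hL h0 le_rfl (hN' j) hx (mem_closedBall_self hR)
          rw [hz, sub_zero, sub_zero] at h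
          rw [mem_closedBall_zero_iff]
          exact h.trans (by gcongr)
        · rw [mem_closedBall_zero_iff]
          exact (norm_gradient_ut_le hd hL h0 (hN' j) hx).trans (by gcongr))
    have hlim₁ : TendstoUniformlyOn (fun m x => ut u (t (φ m + N)) x) (fun x => (f x).1) atTop
        (closedBall (0 : En n) R) := uniformContinuous_fst.comp_tendstoUniformlyOn hlim
    have hlim₂ : TendstoUniformlyOn (fun m x => gradient (ut u (t (φ m + N))) x)
        (fun x => (f x).2) atTop (closedBall (0 : En n) R) :=
      uniformContinuous_snd.comp_tendstoUniformlyOn hlim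
    refine ⟨fun m => φ m + N, fun a b hab => Nat.add_lt_add_right (hφ hab) N,
      fun x => (f x).1, fun x => (f x).2, hf.fst, hf.snd, fun x hx => ?_, hlim₁, hlim₂⟩
    rw [hasGradientAt_iff_hasFDerivAt]
    have hdual := ((InnerProductSpace.toDual ℝ (En n)).isometry.uniformContinuous
      |>.comp_tendstoUniformlyOn hlim₂).mono ball_subset_closedBall
    refine hasFDerivAt_of_tendstoUniformlyOn isOpen_ball hdual (fun m z hz => ?_)
      (fun z hz => hlim₁.tendsto_at (ball_subset_closedBall hz)) hx
    exact (hasGradientAt_ut (hd _ (exp_neg_smul_mem_ball (hN' (φ m))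
      (ball_subset_closedBall hz)))).differentiableAt.hasGradientAt.hasFDerivAt

end
end
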